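/- Let K be a number field that is a Galois extension of ℚ of degree n, with ring of integers O_K. Let S be the set of rational primes p that are unramified in K and split completely in K, i.e., pO_K is a product of n pairwise distinct prime ideals of O_K, each of residue degree 1. Then S is a weakly regular set of primes with Dirichlet density 1/n. -/

import Mathlib

open Filter Topology

/-- The set of rational primes `p` that are unramified in `K` and split completely in `K`:
`p·O_K` is a product of `n` pairwise distinct prime ideals, each of residue degree 1
(i.e., of absolute norm `p`), where `n = [K : ℚ]`. -/
def splitCompletelySet (K : Type*) [Field K] [NumberField K] (n : ℕ) : Set ℕ :=
  {p : ℕ | p.Prime ∧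
    ∃ T : Finset (Ideal (NumberField.RingOfIntegers K)),
      T.card = n ∧ (∀ P ∈ T, P.IsPrime) ∧ (∀ P ∈ T, Ideal.absNorm P = p) ∧
      Ideal.span {(p : NumberField.RingOfIntegers K)} = ∏ P ∈ T, P}

section EulerProduct

open NumberField IsDedekindDomain nonZeroDivisors

variable {K : Type*} [Field K] [NumberField K]

/-- The term `N(I) ^ (-s)` of the Dedekind zeta function. -/
noncomputable def idealCpow (s : ℂ) (I : Ideal (𝓞 K)) : ℂ := (Ideal.absNorm I : ℂ) ^ (-s)

lemma idealCpow_mul (s : ℂ) (I J : Ideal (𝓞 K)) :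
    idealCpow s (I * J) = idealCpow s I * idealCpow s J := by
  simp only [idealCpow, map_mul, Nat.cast_mul, Complex.natCast_mul_natCast_cpow]

lemma idealCpow_one (s : ℂ) : idealCpow s (1 : Ideal (𝓞 K)) = 1 := by
  simp [idealCpow]

lemma norm_idealCpow (s : ℂ) {I : Ideal (𝓞 K)} (hI : I ≠ ⊥) :
    ‖idealCpow s I‖ = (Ideal.absNorm I : ℝ) ^ (-s.re) := by
  rw [idealCpow, Complex.norm_natCast_cpow_of_pos, Complex.neg_re]
  exact Nat.pos_of_ne_zero (by simpa [Ideal.absNorm_eq_zero_iff] using hI)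

/-- The nonzero ideal underlying a height one prime. -/
def primeIdeal₀ (v : HeightOneSpectrum (𝓞 K)) : (Ideal (𝓞 K))⁰ :=
  ⟨v.asIdeal, mem_nonZeroDivisors_of_ne_zero v.ne_bot⟩

omit [NumberField K] in
lemma primeIdeal₀_injective : Function.Injective (primeIdeal₀ (K := K)) := fun _ _ h ↦
  HeightOneSpectrum.ext (congrArg Subtype.val h)

lemma two_le_absNorm_heightOneSpectrum (v : HeightOneSpectrum (𝓞 K)) :
    2 ≤ Ideal.absNorm v.asIdeal := by
  have h0 : Ideal.absNorm v.asIdeal ≠ 0 := by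
    simpa [Ideal.absNorm_eq_zero_iff] using v.ne_bot
  have h1 : Ideal.absNorm v.asIdeal ≠ 1 := by
    simpa [Ideal.absNorm_eq_one_iff] using v.isPrime.ne_top
  omega

lemma norm_idealCpow_lt_one {s : ℂ} (hs : 0 < s.re) (v : HeightOneSpectrum (𝓞 K)) :
    ‖idealCpow s v.asIdeal‖ < 1 := by
  rw [norm_idealCpow _ v.ne_bot]
  have h2 := two_le_absNorm_heightOneSpectrum v
  exact Real.rpow_lt_one_of_one_lt_of_neg (by exact_mod_cast h2) (by linarith)

lemma one_sub_idealCpow_ne_zero {s : ℂ} (hs : 0 < s.re) (v : HeightOneSpectrum (𝓞 K)) :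
    1 - idealCpow s v.asIdeal ≠ 0 := by
  intro h
  have h1 := norm_idealCpow_lt_one hs v
  rw [← sub_eq_zero.mp h, norm_one] at h1
  exact lt_irrefl _ h1

lemma not_dvd_prime_mul_iff {v : HeightOneSpectrum (𝓞 K)} {T : Finset (HeightOneSpectrum (𝓞 K))}
    (hv : v ∉ T) (I : Ideal (𝓞 K)) :
    (∀ w ∈ T, ¬ w.asIdeal ∣ v.asIdeal * I) ↔ ∀ w ∈ T, ¬ w.asIdeal ∣ I := by
  refine forall₂_congr fun w hw ↦ not_congr ?_
  rw [w.prime.dvd_mul]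
  refine or_iff_right fun h ↦ hv ?_
  have hle : v.asIdeal ≤ w.asIdeal := Ideal.le_of_dvd h
  rwa [HeightOneSpectrum.ext (v.isMaximal.eq_of_le w.isPrime.ne_top hle)]

open Classical in
/-- Sieving out from the Dedekind zeta function the ideals divisible by a prime in a finite set. -/
lemma hasSum_ideals_not_dvd {s z : ℂ}
    (hz : HasSum (fun I : (Ideal (𝓞 K))⁰ ↦ idealCpow s (I : Ideal (𝓞 K))) z)
    (T : Finset (HeightOneSpectrum (𝓞 K))) :
    HasSum (fun I : (Ideal (𝓞 K))⁰ ↦ if ∀ v ∈ T, ¬ v.asIdeal ∣ (I : Ideal (𝓞 K)) then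
      idealCpow s (I : Ideal (𝓞 K)) else 0) (z * ∏ v ∈ T, (1 - idealCpow s v.asIdeal)) := by
  induction T using Finset.induction_on with
  | empty => simpa using hz
  | insert v T hv ih =>
    have hinj : Function.Injective fun I : (Ideal (𝓞 K))⁰ ↦ primeIdeal₀ v * I :=
      fun I J h ↦ mul_left_cancel h
    have h2 : HasSum (fun I : (Ideal (𝓞 K))⁰ ↦ if v.asIdeal ∣ (I : Ideal (𝓞 K)) then
        (if ∀ v ∈ T, ¬ v.asIdeal ∣ (I : Ideal (𝓞 K)) then idealCpow s (I : Ideal (𝓞 K)) else 0)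
        else 0) (idealCpow s v.asIdeal * (z * ∏ v ∈ T, (1 - idealCpow s v.asIdeal))) := by
      rw [← hinj.hasSum_iff]
      · refine (ih.mul_left (idealCpow s v.asIdeal)).congr_fun fun I ↦ ?_
        have hc : ((primeIdeal₀ v * I : (Ideal (𝓞 K))⁰) : Ideal (𝓞 K)) = v.asIdeal * I := rfl
        simp only [Function.comp, hc, not_dvd_prime_mul_iff hv, dvd_mul_right, if_true,
          idealCpow_mul, mul_ite, mul_zero]
      · intro I hI
        refine if_neg fun h ↦ hI ?_
        obtain ⟨J, hJ⟩ := h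
        refine ⟨⟨J, mem_nonZeroDivisors_of_ne_zero ?_⟩, Subtype.ext hJ.symm⟩
        rintro rfl
        exact nonZeroDivisors.ne_zero I.2 (by simpa using hJ)
    have h3 := ih.sub h2
    have h4 : z * ∏ w ∈ insert v T, (1 - idealCpow s w.asIdeal) =
        z * ∏ w ∈ T, (1 - idealCpow s w.asIdeal) -
          idealCpow s v.asIdeal * (z * ∏ w ∈ T, (1 - idealCpow s w.asIdeal)) := by
      rw [Finset.prod_insert hv]
      ring
    rw [h4]
    refine h3.congr_fun fun I ↦ ?_
    simp only [Finset.mem_insert, forall_eq_or_imp]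
    by_cases h1 : v.asIdeal ∣ (I : Ideal (𝓞 K)) <;> simp [h1]

/-- The Euler product of the Dedekind zeta function, in exponential form. -/
lemma hasSum_ideals_eq_exp {s : ℂ} (hs : 1 < s.re) {z : ℂ}
    (hz : HasSum (fun I : (Ideal (𝓞 K))⁰ ↦ idealCpow s (I : Ideal (𝓞 K))) z) :
    z = Complex.exp (∑' v : HeightOneSpectrum (𝓞 K), -Complex.log (1 - idealCpow s v.asIdeal)) := by
  classical
  have hsum : Summable fun v : HeightOneSpectrum (𝓞 K) ↦ idealCpow s v.asIdeal :=
    hz.summable.comp_injective (i := primeIdeal₀) primeIdeal₀_injective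
  have hlog : Summable fun v : HeightOneSpectrum (𝓞 K) ↦
      Complex.log (1 - idealCpow s v.asIdeal) := hsum.clog_one_sub
  have hprod : Tendsto (fun T : Finset (HeightOneSpectrum (𝓞 K)) ↦
      ∏ v ∈ T, (1 - idealCpow s v.asIdeal)) atTop
      (𝓝 (Complex.exp (∑' v : HeightOneSpectrum (𝓞 K),
        Complex.log (1 - idealCpow s v.asIdeal)))) := by
    refine ((Complex.continuous_exp.tendsto _).comp hlog.hasSum).congr fun T ↦ ?_
    simp only [Function.comp, Complex.exp_sum,
      Complex.exp_log (one_sub_idealCpow_ne_zero (zero_lt_one.trans hs) _)]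
  have hlim : Tendsto (fun T : Finset (HeightOneSpectrum (𝓞 K)) ↦
      ∑' I : (Ideal (𝓞 K))⁰, if ∀ v ∈ T, ¬ v.asIdeal ∣ (I : Ideal (𝓞 K)) then
        idealCpow s (I : Ideal (𝓞 K)) else 0) atTop
      (𝓝 (∑' I : (Ideal (𝓞 K))⁰, if I = 1 then 1 else 0)) := by
    refine tendsto_tsum_of_dominated_convergence hz.summable.norm (fun I ↦ ?_)
      (Eventually.of_forall fun T I ↦ ?_)
    · by_cases hI : I = 1
      · subst hI
        refine tendsto_const_nhds.congr fun T ↦ ?_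
        have h1 : ∀ v ∈ T, ¬ v.asIdeal ∣ ((1 : (Ideal (𝓞 K))⁰) : Ideal (𝓞 K)) :=
          fun v _ h ↦ v.isPrime.ne_top (Ideal.isUnit_iff.mp (isUnit_of_dvd_one h))
        rw [if_pos rfl, if_pos h1, Submonoid.coe_one, idealCpow_one]
      · have hI' : (I : Ideal (𝓞 K)) ≠ ⊤ :=
          fun h ↦ hI (Subtype.ext (by simpa [Ideal.one_eq_top] using h))
        obtain ⟨M, hM, hle⟩ := Ideal.exists_le_maximal _ hI'
        have hI0 : (I : Ideal (𝓞 K)) ≠ ⊥ := nonZeroDivisors.ne_zero I.2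
        let v : HeightOneSpectrum (𝓞 K) :=
          ⟨M, hM.isPrime, fun h ↦ hI0 (le_bot_iff.mp (h ▸ hle))⟩
        rw [if_neg hI]
        refine tendsto_const_nhds.congr' ?_
        filter_upwards [eventually_ge_atTop {v}] with T hT
        rw [if_neg]
        exact fun h ↦ h v (hT (Finset.mem_singleton_self v)) (Ideal.dvd_iff_le.mpr hle)
    · split_ifs
      · exact le_rfl
      · simp
  simp_rw [fun T ↦ (hasSum_ideals_not_dvd hz T).tsum_eq, tsum_ite_eq] at hlim
  have h1 := tendsto_nhds_unique hlim (hprod.const_mul z)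
  rw [tsum_neg, Complex.exp_neg]
  exact eq_inv_of_mul_eq_one_left h1.symm

end EulerProduct

section Tent

/-- The tent function, whose integer translates form a partition of unity. -/
noncomputable def tent (c : ℝ) : ℝ := max 0 (1 - |c|)

lemma tent_nonneg (c : ℝ) : 0 ≤ tent c := le_max_left _ _

lemma tent_le_one (c : ℝ) : tent c ≤ 1 := max_le zero_le_one (by linarith [abs_nonneg c])

lemma abs_lt_one_of_tent_ne_zero {c : ℝ} (h : tent c ≠ 0) : |c| < 1 := by
  by_contra! hc
  exact h (max_eq_left (by linarith))

lemma abs_tent_sub_le (a b : ℝ) : |tent a - tent b| ≤ |a - b| := by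
  have h1 : |tent a - tent b| ≤ |(1 - |a|) - (1 - |b|)| := by
    simpa [tent] using abs_max_sub_max_le_max 0 (1 - |a|) 0 (1 - |b|)
  refine h1.trans ?_
  rw [sub_sub_sub_cancel_left, abs_sub_comm a b]
  exact abs_abs_sub_abs_le _ _

lemma tent_add_eq_zero {c : ℝ} {n : ℤ} (hn : n ∉ ({-⌊c⌋, -⌊c⌋ - 1} : Finset ℤ)) :
    tent (c + n) = 0 := by
  by_contra h
  have h1 := abs_lt.mp (abs_lt_one_of_tent_ne_zero h)
  have h2 := Int.floor_le c
  have h3 := Int.lt_floor_add_one c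
  have h4 : -⌊c⌋ - 2 < n := by
    have : ((-⌊c⌋ - 2 : ℤ) : ℝ) < n := by push_cast; linarith
    exact_mod_cast this
  have h5 : n < -⌊c⌋ + 1 := by
    have : (n : ℝ) < ((-⌊c⌋ + 1 : ℤ) : ℝ) := by push_cast; linarith
    exact_mod_cast this
  simp only [Finset.mem_insert, Finset.mem_singleton] at hn
  omega

lemma sum_tent (c : ℝ) : ∑ n ∈ ({-⌊c⌋, -⌊c⌋ - 1} : Finset ℤ), tent (c + n) = 1 := by
  have h2 := Int.floor_le c
  have h3 := Int.lt_floor_add_one c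
  rw [Finset.sum_pair (by omega)]
  push_cast
  rw [tent, tent, abs_of_nonneg (by linarith), abs_of_nonpos (by linarith),
    max_eq_right (by linarith), max_eq_right (by linarith)]
  ring

lemma hasSum_prod_tent {ι : Type*} [Fintype ι] (c : ι → ℝ) :
    HasSum (fun n : ι → ℤ ↦ ∏ i, tent (c i + n i)) 1 := by
  classical
  have h : ∑ n ∈ Fintype.piFinset fun i ↦ ({-⌊c i⌋, -⌊c i⌋ - 1} : Finset ℤ),
      ∏ i, tent (c i + n i) = 1 := by
    rw [← Finset.prod_univ_sum (fun i ↦ ({-⌊c i⌋, -⌊c i⌋ - 1} : Finset ℤ))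
      fun i n ↦ tent (c i + n)]
    exact Finset.prod_eq_one fun i _ ↦ sum_tent (c i)
  rw [← h]
  refine hasSum_sum_of_ne_finset_zero fun n hn ↦ ?_
  obtain ⟨i, hi⟩ := by simpa only [Fintype.mem_piFinset, not_forall] using hn
  exact Finset.prod_eq_zero (Finset.mem_univ i) (tent_add_eq_zero hi)

lemma abs_prod_sub_prod_le {ι : Type*} (s : Finset ι) {f g : ι → ℝ}
    (hf : ∀ i, |f i| ≤ 1) (hg : ∀ i, |g i| ≤ 1) :
    |∏ i ∈ s, f i - ∏ i ∈ s, g i| ≤ ∑ i ∈ s, |f i - g i| := by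
  classical
  induction s using Finset.induction_on with
  | empty => simp
  | insert a s ha ih =>
    rw [Finset.prod_insert ha, Finset.prod_insert ha, Finset.sum_insert ha]
    have h1 : |∏ i ∈ s, g i| ≤ 1 := by
      rw [Finset.abs_prod]
      exact Finset.prod_le_one (fun _ _ ↦ abs_nonneg _) fun i _ ↦ hg i
    calc |f a * ∏ i ∈ s, f i - g a * ∏ i ∈ s, g i|
        = |(f a - g a) * ∏ i ∈ s, g i + f a * (∏ i ∈ s, f i - ∏ i ∈ s, g i)| := by ring_nf
      _ ≤ |f a - g a| * |∏ i ∈ s, g i| + |f a| * |∏ i ∈ s, f i - ∏ i ∈ s, g i| := by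
        rw [← abs_mul, ← abs_mul]; exact abs_add_le _ _
      _ ≤ |f a - g a| * 1 + 1 * ∑ i ∈ s, |f i - g i| := by
        gcongr
        exact hf a
      _ = _ := by ring

variable {E ι : Type*} [NormedAddCommGroup E] [NormedSpace ℝ E] [Fintype ι]

/-- The product of tent functions of the coordinates in a basis. -/
noncomputable def tentProd (b : Module.Basis ι ℝ E) (x : E) : ℝ := ∏ i, tent (b.repr x i)

lemma tentProd_nonneg (b : Module.Basis ι ℝ E) (x : E) : 0 ≤ tentProd b x :=
  Finset.prod_nonneg fun _ _ ↦ tent_nonneg _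

lemma tentProd_le_one (b : Module.Basis ι ℝ E) (x : E) : tentProd b x ≤ 1 :=
  Finset.prod_le_one (fun _ _ ↦ tent_nonneg _) fun _ _ ↦ tent_le_one _

lemma hasSum_tentProd (b : Module.Basis ι ℝ E) (x : E) :
    HasSum (fun n : ι → ℤ ↦ tentProd b (∑ i, n i • b i + x)) 1 := by
  classical
  refine (hasSum_prod_tent fun i ↦ b.repr x i).congr_fun fun n ↦ ?_
  refine Finset.prod_congr rfl fun i _ ↦ ?_
  congr 1
  have : ∑ j, n j • b j = ∑ j, (n j : ℝ) • b j :=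
    Finset.sum_congr rfl fun j _ ↦ (Int.cast_smul_eq_zsmul ℝ _ _).symm
  rw [this, map_add, Finsupp.add_apply, b.repr_sum_self (fun j ↦ (n j : ℝ)), add_comm]

lemma exists_norm_le_of_tentProd_ne_zero (b : Module.Basis ι ℝ E) :
    ∃ C, ∀ x, tentProd b x ≠ 0 → ‖x‖ ≤ C := by
  refine ⟨∑ i, ‖b i‖, fun x hx ↦ ?_⟩
  have hx' : ‖∑ i, b.repr x i • b i‖ ≤ ∑ i, ‖b i‖ := by
    refine (norm_sum_le _ _).trans (Finset.sum_le_sum fun i hi ↦ ?_)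
    rw [norm_smul]
    refine mul_le_of_le_one_left (norm_nonneg _) ?_
    exact (abs_lt_one_of_tent_ne_zero (Finset.prod_ne_zero_iff.mp hx i hi)).le
  rwa [b.sum_repr x] at hx'

lemma exists_abs_tentProd_sub_le (b : Module.Basis ι ℝ E) :
    ∃ A, 0 ≤ A ∧ ∀ x y, |tentProd b x - tentProd b y| ≤ A * ‖x - y‖ := by
  have := b.finiteDimensional_of_finite
  let f (i : ι) : E →L[ℝ] ℝ := LinearMap.toContinuousLinearMap (b.coord i)
  refine ⟨∑ i, ‖f i‖, Finset.sum_nonneg fun _ _ ↦ norm_nonneg _, fun x y ↦ ?_⟩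
  have h01 (c : ℝ) : |tent c| ≤ 1 := by
    rw [abs_of_nonneg (tent_nonneg c)]
    exact tent_le_one c
  refine (abs_prod_sub_prod_le _ (fun _ ↦ h01 _) fun _ ↦ h01 _).trans ?_
  rw [Finset.sum_mul]
  refine Finset.sum_le_sum fun i _ ↦ (abs_tent_sub_le _ _).trans ?_
  rw [← Finsupp.sub_apply, ← map_sub]
  exact (f i).le_opNorm (x - y)

end Tent

section Cone

open NumberField NumberField.InfinitePlace NumberField.mixedEmbedding NumberField.Units
  NumberField.Units.dirichletUnitTheorem Module

open scoped Classical

variable {K : Type*} [Field K] [NumberField K]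

/-- The basis of the logarithmic space given by a fundamental system of units. -/
noncomputable def logBasis (K : Type*) [Field K] [NumberField K] :
    Basis (Fin (rank K)) ℝ (logSpace K) :=
  (basisUnitLattice K).ofZLatticeBasis ℝ (unitLattice K)

/-- A function on the mixed space, supported on a cone, whose translates by units add up to the
number of roots of unity. -/
noncomputable def unitWeight (x : mixedSpace K) : ℝ := tentProd (logBasis K) (logMap x)

lemma unitWeight_nonneg (x : mixedSpace K) : 0 ≤ unitWeight x := tentProd_nonneg _ _

lemma unitWeight_le_one (x : mixedSpace K) : unitWeight x ≤ 1 := tentProd_le_one _ _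

lemma unitWeight_unit_smul (ζ : torsion K) (n : Fin (rank K) → ℤ) {x : mixedSpace K}
    (hx : mixedEmbedding.norm x ≠ 0) :
    unitWeight (((ζ : (𝓞 K)ˣ) * ∏ i, fundSystem K i ^ n i) • x) =
      tentProd (logBasis K) (∑ i, n i • logBasis K i + logMap x) := by
  rw [unitWeight, logMap_unit_smul _ hx, ofMul_mul, map_add, logEmbedding_eq_zero_iff.mpr ζ.2,
    zero_add, ofMul_prod, map_sum]
  congr 2
  refine Finset.sum_congr rfl fun i _ ↦ ?_
  rw [ofMul_zpow, map_zsmul, logEmbedding_fundSystem, logBasis, Basis.ofZLatticeBasis_apply]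

lemma hasSum_unitWeight {x : mixedSpace K} (hx : mixedEmbedding.norm x ≠ 0) :
    HasSum (fun u : (𝓞 K)ˣ ↦ unitWeight (u • x)) (torsionOrder K) := by
  have hbij : Function.Bijective fun a : torsion K × (Fin (rank K) → ℤ) ↦
      (a.1 : (𝓞 K)ˣ) * ∏ i, fundSystem K i ^ a.2 i := by
    rw [Function.bijective_iff_existsUnique]
    intro u
    obtain ⟨a, ha, hu⟩ := exist_unique_eq_mul_prod K u
    exact ⟨a, ha.symm, fun b hb ↦ hu b hb.symm⟩
  rw [← (Equiv.ofBijective _ hbij).hasSum_iff]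
  have h1 : HasSum (fun _ : torsion K ↦ (1 : ℝ)) (torsionOrder K) := by
    have := Fintype.ofFinite (torsion K)
    have := hasSum_fintype fun _ : torsion K ↦ (1 : ℝ)
    rwa [Finset.sum_const, Finset.card_univ, nsmul_eq_mul, mul_one,
      ← Nat.card_eq_fintype_card] at this
  have h2 := hasSum_tentProd (logBasis K) (logMap x)
  have h4 := h1.summable.mul_of_nonneg h2.summable (fun _ ↦ zero_le_one)
    fun _ ↦ tentProd_nonneg _ _
  have h3 := h1.mul h2 h4
  rw [mul_one] at h3
  refine h3.congr_fun fun a ↦ ?_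
  rw [one_mul, Function.comp_apply, Equiv.ofBijective_apply, unitWeight_unit_smul a.1 a.2 hx]

/-- The weighted term `φ(x) N(x) ^ (-s)`. -/
noncomputable def coneTerm (s : ℂ) (x : mixedSpace K) : ℂ :=
  if mixedEmbedding.norm x = 0 then 0 else
    (unitWeight x : ℂ) * (mixedEmbedding.norm x : ℂ) ^ (-s)

lemma coneTerm_eq_zero {s : ℂ} {x : mixedSpace K} (hx : mixedEmbedding.norm x = 0) :
    coneTerm s x = 0 := if_pos hx

lemma coneTerm_of_ne_zero {s : ℂ} {x : mixedSpace K} (hx : mixedEmbedding.norm x ≠ 0) :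
    coneTerm s x = (unitWeight x : ℂ) * (mixedEmbedding.norm x : ℂ) ^ (-s) := if_neg hx

lemma differentiable_coneTerm (x : mixedSpace K) : Differentiable ℂ fun s ↦ coneTerm s x := by
  by_cases hx : mixedEmbedding.norm x = 0
  · simp only [coneTerm_eq_zero hx]
    exact differentiable_const _
  · simp only [coneTerm_of_ne_zero hx]
    exact fun s ↦ ((differentiableAt_id.neg).const_cpow
      (Or.inl (Complex.ofReal_ne_zero.mpr hx))).const_mul _

lemma coneTerm_smul (s : ℂ) (x : mixedSpace K) {c : ℝ} (hc : 0 < c) :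
    coneTerm s (c • x) = (c : ℂ) ^ (-(finrank ℚ K * s)) * coneTerm s x := by
  have h : mixedEmbedding.norm (c • x) = c ^ finrank ℚ K * mixedEmbedding.norm x := by
    rw [mixedEmbedding.norm_smul, abs_of_pos hc]
  by_cases hx : mixedEmbedding.norm x = 0
  · rw [coneTerm_eq_zero hx, coneTerm_eq_zero (by rw [h, hx, mul_zero]), mul_zero]
  · have hcx : mixedEmbedding.norm (c • x) ≠ 0 := by
      rw [h]
      exact mul_ne_zero (pow_ne_zero _ hc.ne') hx
    rw [coneTerm_of_ne_zero hx, coneTerm_of_ne_zero hcx, unitWeight,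
      logMap_real_smul hx hc.ne', ← unitWeight, h, Complex.ofReal_mul,
      Complex.mul_cpow_ofReal_nonneg (pow_nonneg hc.le _) (mixedEmbedding.norm_nonneg x),
      Complex.ofReal_pow]
    have h1 : (((c : ℂ) ^ finrank ℚ K) ^ (-s) : ℂ) = (c : ℂ) ^ (-(finrank ℚ K * s)) := by
      have h0 : (c : ℂ).arg = 0 := Complex.arg_ofReal_of_nonneg hc.le
      rw [← mul_neg, Complex.cpow_nat_mul' (by simp [h0, Real.pi_pos])
        (by simp [h0, Real.pi_pos.le])]
    rw [h1]
    ring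

lemma hasSum_coneTerm_unit_smul (s : ℂ) {x : mixedSpace K} (hx : mixedEmbedding.norm x ≠ 0) :
    HasSum (fun u : (𝓞 K)ˣ ↦ coneTerm s (u • x))
      (torsionOrder K * (mixedEmbedding.norm x : ℂ) ^ (-s)) := by
  have h := (Complex.hasSum_ofReal.mpr (hasSum_unitWeight hx)).mul_right
    ((mixedEmbedding.norm x : ℂ) ^ (-s))
  rw [Complex.ofReal_natCast] at h
  refine h.congr_fun fun u ↦ ?_
  rw [coneTerm_of_ne_zero (by rwa [norm_unit_smul]), norm_unit_smul]

end Cone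

section ConeEstimates

open NumberField NumberField.InfinitePlace NumberField.mixedEmbedding NumberField.Units
  NumberField.Units.dirichletUnitTheorem Module

open scoped Classical

variable {K : Type*} [Field K] [NumberField K]

lemma normAtPlace_le_norm (x : mixedSpace K) (w : InfinitePlace K) : normAtPlace w x ≤ ‖x‖ := by
  rw [norm_eq_sup'_normAtPlace]
  exact Finset.le_sup' (fun w ↦ normAtPlace w x) (Finset.mem_univ w)

lemma exists_normAtPlace_eq_norm (x : mixedSpace K) : ∃ w, normAtPlace w x = ‖x‖ := by
  rw [norm_eq_sup'_normAtPlace]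
  obtain ⟨w, -, hw⟩ := Finset.exists_mem_eq_sup' Finset.univ_nonempty fun w ↦ normAtPlace w x
  exact ⟨w, hw.symm⟩

lemma abs_normAtPlace_sub_le (x y : mixedSpace K) (w : InfinitePlace K) :
    |normAtPlace w x - normAtPlace w y| ≤ ‖x - y‖ := by
  have h1 := normAtPlace_add_le w (x - y) y
  have h2 := normAtPlace_add_le w (y - x) x
  rw [sub_add_cancel] at h1 h2
  have h3 := normAtPlace_le_norm (x - y) w
  have h4 : normAtPlace w (y - x) = normAtPlace w (x - y) := by
    rw [← neg_sub, normAtPlace_neg]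
  rw [abs_le]
  constructor <;> linarith

lemma log_mixedEmbedding_norm {x : mixedSpace K} (hx : ∀ w, 0 < normAtPlace w x) :
    Real.log (mixedEmbedding.norm x) = ∑ w, mult w * Real.log (normAtPlace w x) := by
  rw [mixedEmbedding.norm_apply, Real.log_prod fun w _ ↦ (pow_pos (hx w) _).ne']
  simp only [Real.log_pow]




lemma sum_mult_real : ∑ w : InfinitePlace K, (mult w : ℝ) = finrank ℚ K := by
  exact_mod_cast congrArg (Nat.cast (R := ℝ)) (sum_mult_eq (K := K))

lemma abs_log_normAtPlace_sub_le {x : mixedSpace K} (hx : ∀ w, 0 < normAtPlace w x)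
    {C : ℝ} (hC : ‖logMap x‖ ≤ C) (w : InfinitePlace K) :
    |Real.log (normAtPlace w x) - Real.log (mixedEmbedding.norm x) * (finrank ℚ K : ℝ)⁻¹| ≤
      (Fintype.card (InfinitePlace K) + 1) * C := by
  have hC0 : 0 ≤ C := (norm_nonneg _).trans hC
  set A := Real.log (mixedEmbedding.norm x) * (finrank ℚ K : ℝ)⁻¹ with hA
  have hd : (finrank ℚ K : ℝ) ≠ 0 := Nat.cast_ne_zero.mpr finrank_pos.ne'
  have hsum : ∑ w : InfinitePlace K, mult w * (Real.log (normAtPlace w x) - A) = 0 := by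
    simp only [mul_sub, Finset.sum_sub_distrib, ← Finset.sum_mul, sum_mult_real,
      ← log_mixedEmbedding_norm hx, hA]
    field_simp
    ring
  have hle (w : InfinitePlace K) (hw : w ≠ w₀) :
      |mult w * (Real.log (normAtPlace w x) - A)| ≤ C :=
    (norm_le_pi_norm (logMap x) ⟨w, hw⟩).trans hC
  have hcard : (0 : ℝ) ≤ Fintype.card (InfinitePlace K) := Nat.cast_nonneg _
  have hall : |mult w * (Real.log (normAtPlace w x) - A)| ≤
      (Fintype.card (InfinitePlace K) + 1) * C := by
    by_cases hw : w = w₀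
    · subst hw
      rw [← Finset.add_sum_erase _ _ (Finset.mem_univ w₀)] at hsum
      rw [eq_neg_of_add_eq_zero_left hsum, abs_neg]
      refine (Finset.abs_sum_le_sum_abs _ _).trans ((Finset.sum_le_card_nsmul _ _ C
        fun w hw ↦ hle w (Finset.ne_of_mem_erase hw)).trans ?_)
      rw [nsmul_eq_mul]
      gcongr
      have : (Finset.univ.erase (w₀ : InfinitePlace K)).card ≤ Fintype.card (InfinitePlace K) :=
        Finset.card_le_univ _
      have : ((Finset.univ.erase (w₀ : InfinitePlace K)).card : ℝ) ≤
        Fintype.card (InfinitePlace K) := by exact_mod_cast this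
      linarith
    · exact (hle w hw).trans (le_mul_of_one_le_left hC0 (by linarith))
  refine le_trans ?_ hall
  rw [abs_mul, Nat.abs_cast]
  exact le_mul_of_one_le_left (abs_nonneg _) (one_le_mult)

lemma exists_le_normAtPlace (K : Type*) [Field K] [NumberField K] :
    ∃ c : ℝ, 0 < c ∧ ∀ x : mixedSpace K, mixedEmbedding.norm x ≠ 0 → unitWeight x ≠ 0 →
      ∀ w, c * ‖x‖ ≤ normAtPlace w x := by
  obtain ⟨C, hC⟩ := exists_norm_le_of_tentProd_ne_zero (logBasis K)
  set C' := (Fintype.card (InfinitePlace K) + 1) * C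
  refine ⟨Real.exp (-(2 * C')), Real.exp_pos _, fun x hx hw w ↦ ?_⟩
  have hpos (w) : 0 < normAtPlace w x :=
    (normAtPlace_nonneg w x).lt_of_ne' (mixedEmbedding.norm_ne_zero_iff.mp hx w)
  obtain ⟨v, hv⟩ := exists_normAtPlace_eq_norm x
  have h1 := abs_le.mp (abs_log_normAtPlace_sub_le hpos (hC _ hw) v)
  have h2 := abs_le.mp (abs_log_normAtPlace_sub_le hpos (hC _ hw) w)
  rw [← hv, ← Real.exp_log (hpos v), ← Real.exp_add]
  conv_rhs => rw [← Real.exp_log (hpos w)]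
  exact Real.exp_le_exp.mpr (by linarith [h1.2, h2.1])

lemma rpow_le_mixedEmbedding_norm {x : mixedSpace K} {r : ℝ} (hr : 0 ≤ r)
    (h : ∀ w, r ≤ normAtPlace w x) : r ^ finrank ℚ K ≤ mixedEmbedding.norm x := by
  rw [mixedEmbedding.norm_apply, ← sum_mult_eq, ← Finset.prod_pow_eq_pow_sum]
  exact Finset.prod_le_prod (fun _ _ ↦ by positivity) fun w _ ↦ pow_le_pow_left₀ hr (h w) _

end ConeEstimates

section ConeDifference

open NumberField NumberField.InfinitePlace NumberField.mixedEmbedding NumberField.Units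
  NumberField.Units.dirichletUnitTheorem Module

open scoped Classical

variable {K : Type*} [Field K] [NumberField K]

lemma coneTerm_eq_zero_of_not {s : ℂ} {x : mixedSpace K}
    (hx : ¬ (mixedEmbedding.norm x ≠ 0 ∧ unitWeight x ≠ 0)) : coneTerm s x = 0 := by
  by_cases h : mixedEmbedding.norm x = 0
  · exact coneTerm_eq_zero h
  · rw [coneTerm_of_ne_zero h, not_not.mp (not_and.mp hx h), Complex.ofReal_zero, zero_mul]

lemma norm_coneTerm_le {s : ℂ} {x : mixedSpace K} (hx : mixedEmbedding.norm x ≠ 0) :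
    ‖coneTerm s x‖ ≤ mixedEmbedding.norm x ^ (-s.re) := by
  have h0 : 0 < mixedEmbedding.norm x := (mixedEmbedding.norm_nonneg x).lt_of_ne' hx
  rw [coneTerm_of_ne_zero hx, norm_mul, Complex.norm_cpow_eq_rpow_re_of_pos h0, Complex.neg_re,
    Complex.norm_real, Real.norm_of_nonneg (unitWeight_nonneg _)]
  exact mul_le_of_le_one_left (Real.rpow_nonneg h0.le _) (unitWeight_le_one _)

lemma exists_norm_coneTerm_le (K : Type*) [Field K] [NumberField K] :
    ∃ c : ℝ, 0 < c ∧ ∀ (s : ℂ) (x : mixedSpace K), 0 ≤ s.re → x ≠ 0 →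
      ‖coneTerm s x‖ ≤ (c * ‖x‖) ^ (-(finrank ℚ K * s.re)) := by
  obtain ⟨c, hc, h⟩ := exists_le_normAtPlace K
  refine ⟨c, hc, fun s x hs hx ↦ ?_⟩
  have hcx : 0 < c * ‖x‖ := mul_pos hc (norm_pos_iff.mpr hx)
  by_cases hx' : mixedEmbedding.norm x ≠ 0 ∧ unitWeight x ≠ 0
  · refine (norm_coneTerm_le hx'.1).trans ?_
    rw [← mul_neg, Real.rpow_mul hcx.le, Real.rpow_natCast]
    exact Real.rpow_le_rpow_of_nonpos (pow_pos hcx _)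
      (rpow_le_mixedEmbedding_norm hcx.le (h x hx'.1 hx'.2)) (by linarith)
  · rw [coneTerm_eq_zero_of_not hx', norm_zero]
    exact Real.rpow_nonneg hcx.le _

lemma abs_log_sub_log_le {a b p : ℝ} (hp : 0 < p) (ha : p ≤ a) (hb : p ≤ b) :
    |Real.log a - Real.log b| ≤ |a - b| / p := by
  have key {a b : ℝ} (ha : p ≤ a) (hb : p ≤ b) : Real.log a - Real.log b ≤ |a - b| / p := by
    have ha0 : 0 < a := hp.trans_le ha
    have hb0 : 0 < b := hp.trans_le hb
    rw [← Real.log_div ha0.ne' hb0.ne']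
    refine (Real.log_le_sub_one_of_pos (div_pos ha0 hb0)).trans ?_
    rw [div_sub_one hb0.ne']
    exact (div_le_div_of_nonneg_right (le_abs_self _) hb0.le).trans
      (div_le_div_of_nonneg_left (abs_nonneg _) hp hb)
  rw [abs_sub_le_iff]
  exact ⟨key ha hb, abs_sub_comm a b ▸ key hb ha⟩

lemma norm_cpow_sub_cpow_le {a b q σ : ℝ} {s : ℂ} (hq : 1 ≤ q) (ha : q ≤ a) (hb : q ≤ b)
    (hσ : σ ≤ s.re) (hσ0 : 0 ≤ σ) :
    ‖(a : ℂ) ^ (-s) - (b : ℂ) ^ (-s)‖ ≤ ‖s‖ * q ^ (-σ) * |Real.log a - Real.log b| := by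
  have hq0 : 0 < q := zero_lt_one.trans_le hq
  have ha0 : 0 < a := hq0.trans_le ha
  have hb0 : 0 < b := hq0.trans_le hb
  have hderiv (t : ℝ) : HasDerivAt (fun t : ℝ ↦ Complex.exp (t * -s))
      (Complex.exp (t * -s) * -s) t := by
    simpa using ((Complex.ofRealCLM.hasDerivAt (x := t)).mul_const (-s)).cexp
  have hbound (t : ℝ) (ht : t ∈ Set.Ici (Real.log q)) :
      ‖Complex.exp (t * -s) * -s‖ ≤ ‖s‖ * q ^ (-σ) := by
    rw [norm_mul, norm_neg, mul_comm, Complex.norm_exp, Real.rpow_def_of_pos hq0]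
    gcongr
    have h0 : 0 ≤ Real.log q := Real.log_nonneg hq
    have ht' : Real.log q ≤ t := ht
    simp only [Complex.mul_re, Complex.ofReal_re, Complex.neg_re, Complex.ofReal_im, zero_mul,
      sub_zero]
    nlinarith
  have h := (convex_Ici (Real.log q)).norm_image_sub_le_of_norm_hasDerivWithin_le
    (fun t _ ↦ (hderiv t).hasDerivWithinAt) hbound
    (Set.mem_Ici.mpr (Real.log_le_log hq0 hb)) (Set.mem_Ici.mpr (Real.log_le_log hq0 ha))
  rwa [Complex.ofReal_log ha0.le, Complex.ofReal_log hb0.le,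
    ← Complex.cpow_def_of_ne_zero (Complex.ofReal_ne_zero.mpr ha0.ne'),
    ← Complex.cpow_def_of_ne_zero (Complex.ofReal_ne_zero.mpr hb0.ne'), Real.norm_eq_abs] at h

/-- Variation of the summands when both points have all their places at least `p`. -/
lemma norm_coneTerm_sub_le {A : ℝ} (hA0 : 0 ≤ A)
    (hA : ∀ x y, |tentProd (logBasis K) x - tentProd (logBasis K) y| ≤ A * ‖x - y‖)
    {x y : mixedSpace K} {p R₀ R σ : ℝ} {s : ℂ} (hp : 1 ≤ p) (hx : ∀ w, p ≤ normAtPlace w x)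
    (hy : ∀ w, p ≤ normAtPlace w y) (hxy : ‖x - y‖ ≤ R₀) (hσ : σ ≤ s.re) (hσ0 : 0 ≤ σ)
    (hs : ‖s‖ ≤ R) :
    ‖coneTerm s x - coneTerm s y‖ ≤
      (R + 2 * A) * finrank ℚ K * R₀ * p ^ (-(finrank ℚ K * σ + 1)) := by
  have hp0 : 0 < p := zero_lt_one.trans_le hp
  have hR₀ : 0 ≤ R₀ := (norm_nonneg _).trans hxy
  have hR : 0 ≤ R := (norm_nonneg _).trans hs
  have hd : (0 : ℝ) < finrank ℚ K := Nat.cast_pos.mpr finrank_pos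
  have hx0 (w) : 0 < normAtPlace w x := hp0.trans_le (hx w)
  have hy0 (w) : 0 < normAtPlace w y := hp0.trans_le (hy w)
  have hNx := rpow_le_mixedEmbedding_norm hp0.le hx
  have hNy := rpow_le_mixedEmbedding_norm hp0.le hy
  have hq : 1 ≤ p ^ finrank ℚ K := one_le_pow₀ hp
  have hx1 : mixedEmbedding.norm x ≠ 0 := (zero_lt_one.trans_le (hq.trans hNx)).ne'
  have hy1 : mixedEmbedding.norm y ≠ 0 := (zero_lt_one.trans_le (hq.trans hNy)).ne'
  have hplace (w) : |Real.log (normAtPlace w x) - Real.log (normAtPlace w y)| ≤ R₀ / p :=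
    (abs_log_sub_log_le hp0 (hx w) (hy w)).trans
      (div_le_div_of_nonneg_right ((abs_normAtPlace_sub_le x y w).trans hxy) hp0.le)
  have hlogN : |Real.log (mixedEmbedding.norm x) - Real.log (mixedEmbedding.norm y)| ≤
      finrank ℚ K * (R₀ / p) := by
    rw [log_mixedEmbedding_norm hx0, log_mixedEmbedding_norm hy0, ← Finset.sum_sub_distrib,
      ← sum_mult_real, Finset.sum_mul]
    refine (Finset.abs_sum_le_sum_abs _ _).trans (Finset.sum_le_sum fun w _ ↦ ?_)
    rw [← mul_sub, abs_mul, Nat.abs_cast]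
    exact mul_le_mul_of_nonneg_left (hplace w) (Nat.cast_nonneg _)
  have hlogMap : ‖logMap x - logMap y‖ ≤ finrank ℚ K * (2 * (R₀ / p)) := by
    refine (pi_norm_le_iff_of_nonneg (by positivity)).mpr fun w ↦ ?_
    rw [Pi.sub_apply, logMap_apply, logMap_apply, ← mul_sub, norm_mul, Real.norm_natCast,
      sub_sub_sub_comm, ← sub_mul]
    refine mul_le_mul ?_ ?_ (norm_nonneg _) hd.le
    · rw [← sum_mult_real]
      exact Finset.single_le_sum (f := fun w : InfinitePlace K ↦ (mult w : ℝ))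
        (fun _ _ ↦ Nat.cast_nonneg _) (Finset.mem_univ _)
    · refine (norm_sub_le _ _).trans ?_
      rw [two_mul]
      refine add_le_add (hplace w) ?_
      rw [norm_mul, norm_inv, Real.norm_natCast, ← div_eq_mul_inv, div_le_iff₀ hd, mul_comm (R₀ / p)]
      exact hlogN
  have hw : |unitWeight x - unitWeight y| ≤ A * (finrank ℚ K * (2 * (R₀ / p))) :=
    (hA _ _).trans (mul_le_mul_of_nonneg_left hlogMap hA0)
  have hcp := norm_cpow_sub_cpow_le hq hNx hNy hσ hσ0
  have hcy : ‖(mixedEmbedding.norm y : ℂ) ^ (-s)‖ ≤ (p ^ finrank ℚ K) ^ (-σ) := by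
    rw [Complex.norm_cpow_eq_rpow_re_of_pos (zero_lt_one.trans_le (hq.trans hNy)), Complex.neg_re]
    exact (Real.rpow_le_rpow_of_exponent_le (hq.trans hNy) (neg_le_neg hσ)).trans
      (Real.rpow_le_rpow_of_nonpos (zero_lt_one.trans_le hq) hNy (by linarith))
  have hpow : p ^ (-(finrank ℚ K * σ + 1)) = (p ^ finrank ℚ K) ^ (-σ) * p⁻¹ := by
    rw [neg_add, Real.rpow_add hp0, Real.rpow_neg_one, ← mul_neg, Real.rpow_mul hp0.le,
      Real.rpow_natCast]
  have hq' : 0 ≤ (p ^ finrank ℚ K) ^ (-σ) := Real.rpow_nonneg (by positivity) _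
  rw [coneTerm_of_ne_zero hx1, coneTerm_of_ne_zero hy1]
  calc ‖(unitWeight x : ℂ) * (mixedEmbedding.norm x : ℂ) ^ (-s) -
        unitWeight y * (mixedEmbedding.norm y : ℂ) ^ (-s)‖
      = ‖(unitWeight x : ℂ) * ((mixedEmbedding.norm x : ℂ) ^ (-s) -
          (mixedEmbedding.norm y : ℂ) ^ (-s)) +
          ((unitWeight x - unitWeight y : ℝ) : ℂ) * (mixedEmbedding.norm y : ℂ) ^ (-s)‖ := by
        push_cast
        ring_nf
    _ ≤ 1 * (R * (p ^ finrank ℚ K) ^ (-σ) * (finrank ℚ K * (R₀ / p))) +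
        A * (finrank ℚ K * (2 * (R₀ / p))) * (p ^ finrank ℚ K) ^ (-σ) := by
      refine (norm_add_le _ _).trans (add_le_add ?_ ?_)
      · rw [norm_mul]
        refine mul_le_mul ?_ (hcp.trans ?_) (norm_nonneg _) zero_le_one
        · rw [Complex.norm_real, Real.norm_of_nonneg (unitWeight_nonneg _)]
          exact unitWeight_le_one _
        · gcongr
      · rw [norm_mul, Complex.norm_real, Real.norm_eq_abs]
        exact mul_le_mul hw hcy (norm_nonneg _) (by positivity)
    _ = _ := by
      rw [hpow]
      field_simp

lemma norm_mixedEmbedding_eq_absNorm (x : 𝓞 K) :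
    mixedEmbedding.norm (mixedEmbedding K (x : K)) = Ideal.absNorm (Ideal.span {x}) := by
  rw [norm_eq_norm, Ideal.absNorm_span_singleton, ← Algebra.coe_norm_int, Nat.cast_natAbs]
  push_cast
  rfl

lemma one_le_norm_mixedEmbedding {x : 𝓞 K} (hx : x ≠ 0) :
    1 ≤ mixedEmbedding.norm (mixedEmbedding K (x : K)) := by
  rw [norm_mixedEmbedding_eq_absNorm, Nat.one_le_cast, Nat.one_le_iff_ne_zero, Ne,
    Ideal.absNorm_eq_zero_iff, Ideal.span_singleton_eq_bot]
  exact hx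

lemma norm_coneTerm_mixedEmbedding_le_one {s : ℂ} (hs : 0 ≤ s.re) (x : 𝓞 K) :
    ‖coneTerm s (mixedEmbedding K (x : K))‖ ≤ 1 := by
  by_cases hx : x = 0
  · rw [coneTerm_eq_zero (by simp [hx]), norm_zero]
    exact zero_le_one
  · have h := one_le_norm_mixedEmbedding hx
    exact (norm_coneTerm_le (zero_lt_one.trans_le h).ne').trans
      (Real.rpow_le_one_of_one_le_of_nonpos h (by linarith))

lemma exists_norm_coneTerm_sub_le_of_le_norm (K : Type*) [Field K] [NumberField K]
    {R₀ R σ : ℝ} (hR₀ : 0 ≤ R₀) (hR : 0 ≤ R) (hσ0 : 0 ≤ σ) :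
    ∃ B C : ℝ, 0 < B ∧ 0 ≤ C ∧ ∀ (s : ℂ) (x y : mixedSpace K), mixedEmbedding.norm x ≠ 0 →
      unitWeight x ≠ 0 → B ≤ ‖x‖ → ‖x - y‖ ≤ R₀ → σ ≤ s.re → ‖s‖ ≤ R →
      ‖coneTerm s x - coneTerm s y‖ ≤ C * ‖x‖ ^ (-(finrank ℚ K * σ + 1)) := by
  obtain ⟨c, hc, h⟩ := exists_le_normAtPlace K
  obtain ⟨A, hA0, hA⟩ := exists_abs_tentProd_sub_le (logBasis K)
  have hd : (0 : ℝ) < finrank ℚ K := Nat.cast_pos.mpr finrank_pos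
  refine ⟨2 / c * (R₀ + 1),
    (R + 2 * A) * finrank ℚ K * R₀ * (c / 2) ^ (-(finrank ℚ K * σ + 1)), by positivity,
    by positivity, fun s x y hx hw hB hxy hσ hs ↦ ?_⟩
  have hB' : R₀ + 1 ≤ c / 2 * ‖x‖ := by
    calc R₀ + 1 = c / 2 * (2 / c * (R₀ + 1)) := by field_simp
      _ ≤ _ := by gcongr
  have hcx (w) : c * ‖x‖ ≤ normAtPlace w x := h x hx hw w
  have h1 := norm_coneTerm_sub_le hA0 hA (p := c / 2 * ‖x‖) (by linarith)
    (fun w ↦ (by linarith [hcx w])) (fun w ↦ ?_) hxy hσ hσ0 hs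
  · rwa [Real.mul_rpow (by positivity) (norm_nonneg _), ← mul_assoc] at h1
  · linarith [hcx w, (abs_le.mp ((abs_normAtPlace_sub_le x y w).trans hxy)).2]

lemma exists_norm_coneTerm_mixedEmbedding_sub_le (K : Type*) [Field K] [NumberField K]
    {R₀ R σ : ℝ} (hR₀ : 0 ≤ R₀) (hR : 0 ≤ R) (hσ0 : 0 ≤ σ) :
    ∃ C : ℝ, 0 ≤ C ∧ ∀ (s : ℂ) (x y : 𝓞 K), x ≠ 0 →
      ‖mixedEmbedding K (x : K) - mixedEmbedding K (y : K)‖ ≤ R₀ → σ ≤ s.re → ‖s‖ ≤ R →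
      ‖coneTerm s (mixedEmbedding K (x : K)) - coneTerm s (mixedEmbedding K (y : K))‖ ≤
        C * ‖mixedEmbedding K (x : K)‖ ^ (-(finrank ℚ K * σ + 1)) := by
  obtain ⟨B, C, hB, hC, h⟩ := exists_norm_coneTerm_sub_le_of_le_norm K hR₀ hR hσ0
  set e : ℝ := finrank ℚ K * σ + 1 with he
  have he0 : 0 ≤ e := by positivity
  refine ⟨2 * (2 * (B + R₀)) ^ e + C * 2 ^ e, by positivity,
    fun s x y hx hxy hσ hs ↦ ?_⟩
  set X := mixedEmbedding K (x : K)
  set Y := mixedEmbedding K (y : K)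
  have hs0 : 0 ≤ s.re := hσ0.trans hσ
  have hX0 : 0 < ‖X‖ := by
    rw [norm_pos_iff, Ne, map_eq_zero]
    simpa using hx
  have hXe : 0 ≤ ‖X‖ ^ (-e) := Real.rpow_nonneg hX0.le _
  have h2e : 1 ≤ (2 : ℝ) ^ e := Real.one_le_rpow one_le_two he0
  rw [add_mul]
  rcases le_total ‖X‖ (2 * (B + R₀)) with hle | hge
  · have h1 : 1 ≤ (2 * (B + R₀)) ^ e * ‖X‖ ^ (-e) := by
      rw [Real.rpow_neg hX0.le, ← div_eq_mul_inv, one_le_div (Real.rpow_pos_of_pos hX0 _)]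
      exact Real.rpow_le_rpow hX0.le hle he0
    have h2 := norm_sub_le (coneTerm s X) (coneTerm s Y)
    have h3 := norm_coneTerm_mixedEmbedding_le_one hs0 x
    have h4 := norm_coneTerm_mixedEmbedding_le_one hs0 y
    have h5 : 0 ≤ C * 2 ^ e * ‖X‖ ^ (-e) := by positivity
    rw [mul_assoc]
    linarith
  · refine le_trans ?_ (le_add_of_nonneg_left (by positivity))
    by_cases hX : mixedEmbedding.norm X ≠ 0 ∧ unitWeight X ≠ 0
    · refine (h s X Y hX.1 hX.2 (by linarith) hxy hσ hs).trans ?_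
      gcongr
      exact le_mul_of_one_le_right hC h2e
    · by_cases hY : mixedEmbedding.norm Y ≠ 0 ∧ unitWeight Y ≠ 0
      · have hYX : ‖X‖ / 2 ≤ ‖Y‖ := by
          linarith [norm_sub_norm_le X Y]
        rw [norm_sub_rev] at hxy ⊢
        refine (h s Y X hY.1 hY.2 (by linarith) hxy hσ hs).trans ?_
        rw [mul_assoc]
        gcongr
        calc ‖Y‖ ^ (-e) ≤ (‖X‖ / 2) ^ (-e) :=
              Real.rpow_le_rpow_of_nonpos (by positivity) hYX (by linarith)
          _ = 2 ^ e * ‖X‖ ^ (-e) := by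
              rw [Real.div_rpow hX0.le zero_le_two, Real.rpow_neg zero_le_two, div_inv_eq_mul,
                mul_comm]
      · rw [coneTerm_eq_zero_of_not hX, coneTerm_eq_zero_of_not hY, sub_zero, norm_zero]
        positivity

end ConeDifference

section Dilation

/-- Analytic continuation of a series over a lattice whose general term is homogeneous and
varies slowly. -/
lemma exists_differentiableOn_of_homogeneous {ι : Type*} [Fintype ι] {G : ℂ → (ι → ℤ) → ℂ}
    {x₀ : ℝ} {m : ℕ} [NeZero m] {a : ℂ → ℂ}
    (hdiff : ∀ k, Differentiable ℂ fun s ↦ G s k)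
    (hhom : ∀ s k, G s (fun i ↦ k i * m) = a s * G s k)
    (hsum : ∀ s : ℂ, 1 < s.re → Summable (G s))
    (hloc : ∀ s₀ : ℂ, x₀ < s₀.re → ∃ U, IsOpen U ∧ s₀ ∈ U ∧ ∃ u : (ι → ℤ) → ℝ, Summable u ∧
      ∀ (r : ι → Fin m) (q : ι → ℤ), ∀ s ∈ U,
        ‖G s (fun i ↦ q i * m + (r i : ℕ)) - G s (fun i ↦ q i * m)‖ ≤ u q) :
    ∃ H : ℂ → ℂ, DifferentiableOn ℂ H {s | x₀ < s.re} ∧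
      ∀ s : ℂ, 1 < s.re → (∑' k, G s k) * (1 - m ^ Fintype.card ι * a s) = H s := by
  classical
  let D (s : ℂ) (q : ι → ℤ) : ℂ :=
    ∑ r : ι → Fin m, (G s (fun i ↦ q i * m + (r i : ℕ)) - G s (fun i ↦ q i * m))
  refine ⟨fun s ↦ ∑' q, D s q, fun s₀ hs₀ ↦ ?_, fun s hs ↦ ?_⟩
  · obtain ⟨U, hU, hsU, u, hu, hle⟩ := hloc s₀ hs₀
    refine DifferentiableAt.differentiableWithinAt ?_
    refine (Complex.differentiableOn_tsum_of_summable_norm (F := fun q s ↦ D s q)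
      (hu.mul_left (Fintype.card (ι → Fin m) : ℝ)) (fun q ↦ ?_) hU fun q s hs ↦ ?_).differentiableAt
      (hU.mem_nhds hsU)
    · exact (Differentiable.fun_sum fun r _ ↦ (hdiff _).sub (hdiff _)).differentiableOn
    · refine (norm_sum_le _ _).trans ((Finset.sum_le_card_nsmul _ _ (u q)
        fun r _ ↦ hle r q s hs).trans_eq ?_)
      rw [nsmul_eq_mul, Finset.card_univ]
  · let e : (ι → ℤ) ≃ (ι → ℤ) × (ι → Fin m) :=
      (Equiv.piCongrRight fun _ ↦ Int.divModEquiv m).trans (Equiv.arrowProdEquivProdArrow ι _ _)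
    have h1 := e.symm.hasSum_iff.mpr (hsum s hs).hasSum
    have h2 : HasSum (fun q : ι → ℤ ↦ ∑ r : ι → Fin m, G s (fun i ↦ q i * m + (r i : ℕ)))
        (∑' k, G s k) :=
      h1.prod_fiberwise fun q ↦ hasSum_fintype _
    have h3 := h2.sub ((hsum s hs).hasSum.mul_left (m ^ Fintype.card ι * a s))
    have h4 : (∑' k, G s k) * (1 - m ^ Fintype.card ι * a s) =
        (∑' k, G s k) - m ^ Fintype.card ι * a s * ∑' k, G s k := by ring
    rw [h4]
    refine (HasSum.congr_fun h3 fun q ↦ ?_).tsum_eq.symm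
    simp only [D, Finset.sum_sub_distrib, hhom, Finset.sum_const, Finset.card_univ, nsmul_eq_mul,
      Fintype.card_fun, Fintype.card_fin, Nat.cast_pow, mul_assoc]

end Dilation

section IdealZeta

open NumberField NumberField.InfinitePlace NumberField.mixedEmbedding NumberField.Units
  NumberField.Units.dirichletUnitTheorem Module nonZeroDivisors

open scoped Classical

variable {K : Type*} [Field K] [NumberField K]

lemma summable_norm_mixedEmbedding_rpow (K : Type*) [Field K] [NumberField K] {r : ℝ}
    (hr : finrank ℚ K < r) :
    Summable fun x : 𝓞 K ↦ ‖mixedEmbedding K (x : K)‖ ^ (-r) := by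
  have hrank : finrank ℤ (mixedEmbedding.integerLattice K) = finrank ℚ K := by
    rw [ZLattice.rank ℝ, mixedEmbedding.finrank]
  have h := ZLattice.summable_norm_rpow (mixedEmbedding.integerLattice K) (-r)
    (by rw [hrank]; linarith)
  let f (x : 𝓞 K) : mixedEmbedding.integerLattice K :=
    ⟨mixedEmbedding K (x : K), ⟨x, rfl⟩⟩
  have hf : Function.Injective f := fun x y hxy ↦
    RingOfIntegers.ext (mixedEmbedding_injective K (congrArg Subtype.val hxy))
  exact h.comp_injective (i := f) hf

lemma summable_coneTerm {s : ℂ} (hs : 1 < s.re) :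
    Summable fun x : 𝓞 K ↦ coneTerm s (mixedEmbedding K (x : K)) := by
  obtain ⟨c, hc, h⟩ := exists_norm_coneTerm_le K
  have hd : (0 : ℝ) < finrank ℚ K := Nat.cast_pos.mpr finrank_pos
  refine Summable.of_norm_bounded ((summable_norm_mixedEmbedding_rpow K
    (r := finrank ℚ K * s.re) (by nlinarith)).mul_left (c ^ (-(finrank ℚ K * s.re)))) fun x ↦ ?_
  by_cases hx : x = 0
  · rw [coneTerm_eq_zero (by simp [hx]), norm_zero]
    positivity
  · rw [← Real.mul_rpow hc.le (norm_nonneg _)]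
    refine h s _ (by linarith) ?_
    rw [Ne, map_eq_zero]
    simpa using hx

lemma exists_differentiableOn_tsum_coneTerm {J : Ideal (𝓞 K)} (hJ : J ≠ ⊥) (m : ℕ) [NeZero m] :
    ∃ H : ℂ → ℂ, DifferentiableOn ℂ H {s | 1 - (finrank ℚ K : ℝ)⁻¹ < s.re} ∧
      ∀ s : ℂ, 1 < s.re → (∑' x : J, coneTerm s (mixedEmbedding K ((x : 𝓞 K) : K))) *
        (1 - m ^ finrank ℚ K * (m : ℂ) ^ (-(finrank ℚ K * s))) = H s := by
  have hd : (0 : ℝ) < finrank ℚ K := Nat.cast_pos.mpr finrank_pos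
  have hd1 : (1 : ℝ) ≤ finrank ℚ K := by exact_mod_cast (finrank_pos : 0 < finrank ℚ K)
  have hm : (0 : ℝ) < m := Nat.cast_pos.mpr (NeZero.pos m)
  let b := Ideal.selfBasis (RingOfIntegers.basis K) J hJ
  let T := b.equivFun.symm
  have hcard : Fintype.card (Free.ChooseBasisIndex ℤ (𝓞 K)) = finrank ℚ K := by
    rw [← finrank_eq_card_chooseBasisIndex, RingOfIntegers.rank]
  let ψ (k : Free.ChooseBasisIndex ℤ (𝓞 K) → ℤ) : mixedSpace K :=
    mixedEmbedding K ((T k : 𝓞 K) : K)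
  have hψ_add (k l) : ψ (k + l) = ψ k + ψ l := by simp [ψ]
  have hψ_smul (k) : ψ (fun i ↦ k i * m) = (m : ℝ) • ψ k := by
    have : (fun i ↦ k i * (m : ℤ)) = (m : ℤ) • k := by
      ext i
      simp [mul_comm]
    rw [this, natCast_zsmul, Nat.cast_smul_eq_nsmul]
    exact map_nsmul ((mixedEmbedding K).toAddMonoidHom.comp
      ((algebraMap (𝓞 K) K).toAddMonoidHom.comp
        (J.toAddSubmonoid.subtype.comp (T : _ →+ J)))) m k
  have hT : Function.Injective fun k ↦ (T k : 𝓞 K) := Subtype.val_injective.comp T.injective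
  have hloc (s₀ : ℂ) (hs₀ : 1 - (finrank ℚ K : ℝ)⁻¹ < s₀.re) :
      ∃ U, IsOpen U ∧ s₀ ∈ U ∧ ∃ u : (Free.ChooseBasisIndex ℤ (𝓞 K) → ℤ) → ℝ, Summable u ∧
        ∀ (r : Free.ChooseBasisIndex ℤ (𝓞 K) → Fin m) (q : Free.ChooseBasisIndex ℤ (𝓞 K) → ℤ),
          ∀ s ∈ U, ‖coneTerm s (ψ fun i ↦ q i * m + (r i : ℕ)) -
            coneTerm s (ψ fun i ↦ q i * m)‖ ≤ u q := by
    obtain ⟨σ, hσ1, hσ2⟩ := exists_between hs₀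
    have hσ0 : 0 ≤ σ := by
      have : (finrank ℚ K : ℝ)⁻¹ ≤ 1 := inv_le_one_of_one_le₀ hd1
      linarith
    have hσd : finrank ℚ K < finrank ℚ K * σ + 1 := by
      have := mul_lt_mul_of_pos_left hσ1 hd
      rw [mul_sub, mul_inv_cancel₀ hd.ne'] at this
      linarith
    let R₀ : ℝ := ∑ r : Free.ChooseBasisIndex ℤ (𝓞 K) → Fin m, ‖ψ fun i ↦ ((r i : ℕ) : ℤ)‖
    have hR₀ : 0 ≤ R₀ := Finset.sum_nonneg fun _ _ ↦ norm_nonneg _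
    obtain ⟨C, hC, h⟩ := exists_norm_coneTerm_mixedEmbedding_sub_le K hR₀
      (R := ‖s₀‖ + 1) (by positivity) hσ0
    refine ⟨{s | σ < s.re} ∩ Metric.ball 0 (‖s₀‖ + 1),
      (isOpen_lt continuous_const Complex.continuous_re).inter Metric.isOpen_ball,
      ⟨hσ2, by simp⟩, fun q ↦ C * (m : ℝ) ^ (-(finrank ℚ K * σ + 1)) *
        ‖ψ q‖ ^ (-(finrank ℚ K * σ + 1)) + if q = 0 then 2 else 0, ?_, fun r q s hs ↦ ?_⟩
    · refine Summable.add (((summable_norm_mixedEmbedding_rpow K hσd).comp_injective hT).mul_left _)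
        (summable_of_ne_finset_zero (s := {0}) fun q hq ↦ if_neg ?_)
      simpa using hq
    · have hsσ : σ < s.re := hs.1
      have hsR : ‖s‖ < ‖s₀‖ + 1 := by simpa using hs.2
      have hψ0 : 0 ≤ ‖ψ q‖ ^ (-(finrank ℚ K * σ + 1)) := Real.rpow_nonneg (norm_nonneg _) _
      beta_reduce
      by_cases hq : q = 0
      · rw [if_pos hq]
        have h1 := norm_coneTerm_mixedEmbedding_le_one (s := s) (by linarith)
          (T fun i ↦ q i * m + (r i : ℕ)).1
        have h2 := norm_coneTerm_mixedEmbedding_le_one (s := s) (by linarith) (T fun i ↦ q i * m).1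
        have h3 : 0 ≤ C * (m : ℝ) ^ (-(finrank ℚ K * σ + 1)) *
          ‖ψ q‖ ^ (-(finrank ℚ K * σ + 1)) := by positivity
        refine (norm_sub_le _ _).trans ?_
        simp only [ψ]
        linarith
      · rw [if_neg hq, add_zero, norm_sub_rev]
        have hne : (T fun i ↦ q i * m : 𝓞 K) ≠ 0 := by
          rw [Ne, ZeroMemClass.coe_eq_zero, LinearEquiv.map_eq_zero_iff]
          intro h0
          refine hq (funext fun i ↦ ?_)
          simpa [NeZero.ne m] using congrFun h0 i
        refine (h s (T fun i ↦ q i * m).1 (T fun i ↦ q i * m + (r i : ℕ)).1 hne ?_ hsσ.le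
          hsR.le).trans_eq ?_
        · change ‖ψ _ - ψ _‖ ≤ R₀
          have : (fun i ↦ q i * (m : ℤ) + (r i : ℕ)) =
              (fun i ↦ q i * (m : ℤ)) + fun i ↦ ((r i : ℕ) : ℤ) := rfl
          rw [this, hψ_add, sub_add_cancel_left, norm_neg]
          exact Finset.single_le_sum (f := fun r : Free.ChooseBasisIndex ℤ (𝓞 K) → Fin m ↦
            ‖ψ fun i ↦ ((r i : ℕ) : ℤ)‖) (fun _ _ ↦ norm_nonneg _) (Finset.mem_univ r)
        · change C * ‖ψ _‖ ^ _ = _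
          rw [hψ_smul, _root_.norm_smul, Real.norm_of_nonneg hm.le,
            Real.mul_rpow hm.le (norm_nonneg _), mul_assoc]
  obtain ⟨H, hH, hHs⟩ := exists_differentiableOn_of_homogeneous
    (G := fun s k ↦ coneTerm s (ψ k)) (x₀ := 1 - (finrank ℚ K : ℝ)⁻¹) (m := m)
    (a := fun s ↦ (m : ℂ) ^ (-(finrank ℚ K * s))) (fun k ↦ differentiable_coneTerm _)
    (fun s k ↦ by rw [hψ_smul, coneTerm_smul _ _ hm, Complex.ofReal_natCast])
    (fun s hs ↦ (summable_coneTerm hs).comp_injective hT) hloc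
  refine ⟨H, hH, fun s hs ↦ ?_⟩
  rw [← hHs s hs, hcard]
  congr 1
  exact (T.toEquiv.tsum_eq fun x : J ↦ coneTerm s (mixedEmbedding K ((x : 𝓞 K) : K))).symm

end IdealZeta

section DedekindZeta

open NumberField NumberField.InfinitePlace NumberField.mixedEmbedding NumberField.Units Module
  nonZeroDivisors

variable {K : Type*} [Field K] [NumberField K]

lemma idealCpow_ne_zero (s : ℂ) {I : Ideal (𝓞 K)} (hI : I ≠ ⊥) : idealCpow s I ≠ 0 := by
  rw [← norm_ne_zero_iff, norm_idealCpow s hI]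
  have : 0 < Ideal.absNorm I := Nat.pos_of_ne_zero (by simpa [Ideal.absNorm_eq_zero_iff] using hI)
  positivity

/-- Nonzero elements of `J` correspond to ideals `I` in the inverse class together with a unit. -/
lemma exists_bijective_ideal_prod_unit {C : ClassGroup (𝓞 K)} {J : (Ideal (𝓞 K))⁰}
    (hJ : ClassGroup.mk0 J = C⁻¹) :
    ∃ y : {I : (Ideal (𝓞 K))⁰ // ClassGroup.mk0 I = C} → 𝓞 K,
      (∀ I, Ideal.span {y I} = (J : Ideal (𝓞 K)) * (I.1 : Ideal (𝓞 K))) ∧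
      ∃ f : {I : (Ideal (𝓞 K))⁰ // ClassGroup.mk0 I = C} × (𝓞 K)ˣ →
          {x : (J : Ideal (𝓞 K)) | x ≠ 0},
        Function.Bijective f ∧ ∀ a, ((f a : (J : Ideal (𝓞 K))) : 𝓞 K) = a.2 * y a.1 := by
  have hy (I : {I : (Ideal (𝓞 K))⁰ // ClassGroup.mk0 I = C}) :
      ∃ y : 𝓞 K, Ideal.span {y} = (J : Ideal (𝓞 K)) * (I.1 : Ideal (𝓞 K)) := by
    have h1 : ClassGroup.mk0 (J * I.1) = 1 := by rw [map_mul, hJ, I.2, inv_mul_cancel]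
    have h2 := (ClassGroup.mk0_eq_one_iff (J * I.1).2).mp h1
    exact ⟨h2.generator, Ideal.span_singleton_generator _⟩
  choose y hy using hy
  have hy0 (I) : y I ≠ 0 := by
    intro h0
    have := hy I
    rw [h0, Ideal.span_singleton_eq_bot.mpr rfl] at this
    exact mul_ne_zero (nonZeroDivisors.coe_ne_zero J) (nonZeroDivisors.coe_ne_zero I.1) this.symm
  have hspan (a : {I : (Ideal (𝓞 K))⁰ // ClassGroup.mk0 I = C} × (𝓞 K)ˣ) :
      Ideal.span {(a.2 : 𝓞 K) * y a.1} = (J : Ideal (𝓞 K)) * (a.1.1 : Ideal (𝓞 K)) := by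
    rw [← hy, Ideal.span_singleton_mul_left_unit a.2.isUnit]
  have hmem (a : {I : (Ideal (𝓞 K))⁰ // ClassGroup.mk0 I = C} × (𝓞 K)ˣ) :
      (a.2 : 𝓞 K) * y a.1 ∈ (J : Ideal (𝓞 K)) := by
    have h1 := Ideal.mem_span_singleton_self ((a.2 : 𝓞 K) * y a.1)
    rw [hspan] at h1
    have h2 : (J : Ideal (𝓞 K)) * (a.1.1 : Ideal (𝓞 K)) ≤ J := Ideal.dvd_iff_le.mp ⟨_, rfl⟩
    exact h2 h1
  refine ⟨y, hy, fun a ↦ ⟨⟨(a.2 : 𝓞 K) * y a.1, hmem a⟩, ?_⟩, ⟨?_, ?_⟩, fun a ↦ rfl⟩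
  · exact fun h ↦ mul_ne_zero a.2.ne_zero (hy0 a.1) (congrArg Subtype.val h)
  · rintro ⟨I, u⟩ ⟨I', u'⟩ h
    have h1 : (u : 𝓞 K) * y I = u' * y I' := congrArg (fun z ↦ ((z.1 : (J : Ideal (𝓞 K))) : 𝓞 K)) h
    have h2 := (hspan (I, u)).symm.trans ((congrArg (fun z ↦ Ideal.span {z}) h1).trans
      (hspan (I', u')))
    have h3 : I = I' := Subtype.ext (Subtype.ext (mul_left_cancel₀ (nonZeroDivisors.coe_ne_zero J) h2))
    subst h3
    rw [mul_left_inj' (hy0 I)] at h1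
    rw [Units.ext h1]
  · rintro ⟨⟨x, hxJ⟩, hx⟩
    have hx0 : x ≠ 0 := fun h ↦ hx (Subtype.ext h)
    obtain ⟨I, hI⟩ := Ideal.dvd_iff_le.mpr ((Ideal.span_singleton_le_iff_mem _).mpr hxJ)
    have hI0 : I ≠ 0 := by
      rintro rfl
      rw [mul_zero, Ideal.zero_eq_bot, Ideal.span_singleton_eq_bot] at hI
      exact hx0 hI
    let I' : (Ideal (𝓞 K))⁰ := ⟨I, mem_nonZeroDivisors_of_ne_zero hI0⟩
    have hC : ClassGroup.mk0 I' = C := by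
      have h1 : ClassGroup.mk0 (J * I') = 1 :=
        (ClassGroup.mk0_eq_one_iff (J * I').2).mpr ⟨x, hI.symm⟩
      rw [map_mul, hJ, inv_mul_eq_one] at h1
      exact h1.symm
    have h2 : Ideal.span {y ⟨I', hC⟩} = Ideal.span {x} := (hy ⟨I', hC⟩).trans hI.symm
    obtain ⟨u, hu⟩ := Ideal.span_singleton_eq_span_singleton.mp h2
    exact ⟨(⟨I', hC⟩, u), Subtype.ext (Subtype.ext ((mul_comm _ _).trans hu))⟩

lemma hasSum_idealCpow_class {C : ClassGroup (𝓞 K)} {J : (Ideal (𝓞 K))⁰}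
    (hJ : ClassGroup.mk0 J = C⁻¹) {s : ℂ} (hs : 1 < s.re) :
    HasSum (fun I : {I : (Ideal (𝓞 K))⁰ // ClassGroup.mk0 I = C} ↦
        idealCpow s ((I : (Ideal (𝓞 K))⁰) : Ideal (𝓞 K)))
      ((torsionOrder K * idealCpow s (J : Ideal (𝓞 K)))⁻¹ *
        ∑' x : (J : Ideal (𝓞 K)), coneTerm s (mixedEmbedding K ((x : 𝓞 K) : K))) := by
  obtain ⟨y, hy, f, hf, hfy⟩ := exists_bijective_ideal_prod_unit hJ
  have h1 : HasSum (fun x : (J : Ideal (𝓞 K)) ↦ coneTerm s (mixedEmbedding K ((x : 𝓞 K) : K)))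
      (∑' x : (J : Ideal (𝓞 K)), coneTerm s (mixedEmbedding K ((x : 𝓞 K) : K))) :=
    ((summable_coneTerm hs).comp_injective (i := fun x : (J : Ideal (𝓞 K)) ↦ (x : 𝓞 K))
      Subtype.val_injective).hasSum
  have h2 := (hasSum_subtype_iff_of_support_subset (s := {x : (J : Ideal (𝓞 K)) | x ≠ 0})
    (fun x hx ↦ by
      rintro rfl
      exact hx (coneTerm_eq_zero (by simp)))).mpr h1
  have h3 := (Equiv.ofBijective f hf).hasSum_iff.mpr h2
  have hc : (torsionOrder K * idealCpow s (J : Ideal (𝓞 K)) : ℂ) ≠ 0 :=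
    mul_ne_zero (Nat.cast_ne_zero.mpr (torsionOrder_ne_zero K))
      (idealCpow_ne_zero s (nonZeroDivisors.coe_ne_zero J))
  have h4 (I : {I : (Ideal (𝓞 K))⁰ // ClassGroup.mk0 I = C}) :
      HasSum (fun u : (𝓞 K)ˣ ↦ ((fun x : (J : Ideal (𝓞 K)) ↦
          coneTerm s (mixedEmbedding K ((x : 𝓞 K) : K))) ∘ Subtype.val ∘ f) (I, u))
        ((torsionOrder K * idealCpow s (J : Ideal (𝓞 K))) *
          idealCpow s ((I : (Ideal (𝓞 K))⁰) : Ideal (𝓞 K))) := by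
    have hnorm : mixedEmbedding.norm (mixedEmbedding K (y I : K)) =
        Ideal.absNorm ((J : Ideal (𝓞 K)) * (I.1 : Ideal (𝓞 K))) := by
      rw [norm_mixedEmbedding_eq_absNorm, hy]
    have h5 := hasSum_coneTerm_unit_smul s (x := mixedEmbedding K (y I : K)) (by
      rw [hnorm, Nat.cast_ne_zero]
      exact Ideal.absNorm_ne_zero_of_nonZeroDivisors (J * I.1))
    rw [hnorm, Complex.ofReal_natCast] at h5
    rw [mul_assoc, ← idealCpow_mul]
    refine HasSum.congr_fun h5 fun u ↦ ?_
    simp only [Function.comp_apply, hfy, unitSMul_smul, map_mul]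
  have h5 := (HasSum.prod_fiberwise h3 h4).mul_left
    (torsionOrder K * idealCpow s (J : Ideal (𝓞 K)))⁻¹
  refine h5.congr_fun fun I ↦ ?_
  rw [inv_mul_cancel_left₀ hc]

variable (K) in
/-- The sum of `N(I) ^ (-s)` over all nonzero ideals. -/
noncomputable def idealZeta (s : ℂ) : ℂ := ∑' I : (Ideal (𝓞 K))⁰, idealCpow s (I : Ideal (𝓞 K))

lemma hasSum_idealCpow_of_class {s : ℂ} {a : ClassGroup (𝓞 K) → ℂ}
    (h : ∀ C, HasSum (fun I : {I : (Ideal (𝓞 K))⁰ // ClassGroup.mk0 I = C} ↦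
        idealCpow s ((I : (Ideal (𝓞 K))⁰) : Ideal (𝓞 K))) (a C)) :
    HasSum (fun I : (Ideal (𝓞 K))⁰ ↦ idealCpow s (I : Ideal (𝓞 K))) (∑ C, a C) := by
  classical
  let f (I : (Ideal (𝓞 K))⁰) : ℂ := idealCpow s (I : Ideal (𝓞 K))
  have h' (C) : HasSum (Set.indicator {I : (Ideal (𝓞 K))⁰ | ClassGroup.mk0 I = C} f) (a C) := by
    rw [← hasSum_subtype_iff_indicator]
    exact h C
  refine HasSum.congr_fun (hasSum_sum fun C _ ↦ h' C) fun I ↦ ?_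
  have hI (C : ClassGroup (𝓞 K)) : Set.indicator {I : (Ideal (𝓞 K))⁰ | ClassGroup.mk0 I = C} f I =
      if ClassGroup.mk0 I = C then f I else 0 := Set.indicator_apply _ _ _
  simp only [hI, Finset.sum_ite_eq, Finset.mem_univ, if_true]
  rfl

lemma hasSum_idealZeta {s : ℂ} (hs : 1 < s.re) :
    HasSum (fun I : (Ideal (𝓞 K))⁰ ↦ idealCpow s (I : Ideal (𝓞 K))) (idealZeta K s) := by
  have h (C : ClassGroup (𝓞 K)) : ∃ a, HasSum (fun I : {I : (Ideal (𝓞 K))⁰ //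
      ClassGroup.mk0 I = C} ↦ idealCpow s ((I : (Ideal (𝓞 K))⁰) : Ideal (𝓞 K))) a := by
    obtain ⟨J, hJ⟩ := ClassGroup.mk0_surjective C⁻¹
    exact ⟨_, hasSum_idealCpow_class hJ hs⟩
  choose a ha using h
  exact (hasSum_idealCpow_of_class ha).summable.hasSum

lemma exists_differentiableOn_idealZeta (m : ℕ) [NeZero m] :
    ∃ H : ℂ → ℂ, DifferentiableOn ℂ H {s | 1 - (finrank ℚ K : ℝ)⁻¹ < s.re} ∧
      ∀ s : ℂ, 1 < s.re → idealZeta K s *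
        (1 - m ^ finrank ℚ K * (m : ℂ) ^ (-(finrank ℚ K * s))) = H s := by
  choose J hJ using fun C : ClassGroup (𝓞 K) ↦ ClassGroup.mk0_surjective C⁻¹
  choose H hH hHs using fun C ↦ exists_differentiableOn_tsum_coneTerm
    (nonZeroDivisors.coe_ne_zero (J C)) m
  have hc (s : ℂ) (C) : (torsionOrder K * idealCpow s (J C : Ideal (𝓞 K)) : ℂ) ≠ 0 :=
    mul_ne_zero (Nat.cast_ne_zero.mpr (torsionOrder_ne_zero K))
      (idealCpow_ne_zero s (nonZeroDivisors.coe_ne_zero (J C)))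
  refine ⟨fun s ↦ ∑ C, (torsionOrder K * idealCpow s (J C : Ideal (𝓞 K)))⁻¹ * H C s,
    DifferentiableOn.fun_sum fun C _ ↦ DifferentiableOn.mul (DifferentiableOn.inv ?_
      fun s _ ↦ hc s C) (hH C), fun s hs ↦ ?_⟩
  · have h0 : ((Ideal.absNorm (J C : Ideal (𝓞 K)) : ℕ) : ℂ) ≠ 0 :=
      Nat.cast_ne_zero.mpr (Ideal.absNorm_ne_zero_of_nonZeroDivisors (J C))
    exact (Differentiable.const_mul (fun s ↦ differentiableAt_neg_iff.mpr
      differentiableAt_id |>.const_cpow (Or.inl h0)) _).differentiableOn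
  · rw [idealZeta, (hasSum_idealCpow_of_class
      fun C ↦ hasSum_idealCpow_class (hJ C) hs).tsum_eq, Finset.sum_mul]
    refine Finset.sum_congr rfl fun C _ ↦ ?_
    rw [← hHs C s hs, mul_assoc]

end DedekindZeta

section LocalZeta

open NumberField IsDedekindDomain Module nonZeroDivisors

variable {K : Type*} [Field K] [NumberField K]

lemma dedekindZeta_eq_idealZeta {s : ℂ} (hs : 1 < s.re) : dedekindZeta K s = idealZeta K s := by
  have h := (hasSum_idealZeta (K := K) hs).tsum_fiberwise
    fun I : (Ideal (𝓞 K))⁰ ↦ Ideal.absNorm (I : Ideal (𝓞 K))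
  rw [dedekindZeta, LSeries, ← h.tsum_eq]
  refine tsum_congr fun n ↦ ?_
  have hfib (I : (fun I : (Ideal (𝓞 K))⁰ ↦ Ideal.absNorm (I : Ideal (𝓞 K))) ⁻¹' {n}) :
      idealCpow s ((I : (Ideal (𝓞 K))⁰) : Ideal (𝓞 K)) = (n : ℂ) ^ (-s) := by
    rw [idealCpow, show Ideal.absNorm ((I : (Ideal (𝓞 K))⁰) : Ideal (𝓞 K)) = n from I.2]
  rw [tsum_congr hfib, tsum_const, nsmul_eq_mul]
  rcases eq_or_ne n 0 with rfl | hn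
  · rw [LSeries.term_zero, Nat.card_eq_zero.mpr, Nat.cast_zero, zero_mul]
    refine Or.inl ⟨fun I ↦ ?_⟩
    exact Ideal.absNorm_ne_zero_of_nonZeroDivisors I.1 I.2
  · rw [LSeries.term_of_ne_zero hn, Complex.cpow_neg, div_eq_mul_inv]
    congr 2
    refine Nat.card_congr ⟨fun I ↦ ⟨⟨I.1, mem_nonZeroDivisors_of_ne_zero ?_⟩, I.2⟩,
      fun I ↦ ⟨I.1, I.2⟩, fun I ↦ rfl, fun I ↦ rfl⟩
    rintro h0
    exact hn (by rw [← I.2, h0]; simp)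

lemma summable_idealCpow_heightOneSpectrum {s : ℂ} (hs : 1 < s.re) :
    Summable fun v : HeightOneSpectrum (𝓞 K) ↦ idealCpow s v.asIdeal :=
  (hasSum_idealZeta (K := K) hs).summable.comp_injective (i := primeIdeal₀) primeIdeal₀_injective

lemma summable_neg_log_one_sub_idealCpow {s : ℂ} (hs : 1 < s.re) :
    Summable fun v : HeightOneSpectrum (𝓞 K) ↦ -Complex.log (1 - idealCpow s v.asIdeal) :=
  (summable_idealCpow_heightOneSpectrum hs).clog_one_sub.neg

variable (K) in
/-- The logarithm of the Dedekind zeta function given by the Euler product. -/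
noncomputable def logIdealZeta (s : ℂ) : ℂ :=
  ∑' v : HeightOneSpectrum (𝓞 K), -Complex.log (1 - idealCpow s v.asIdeal)

lemma idealZeta_eq_exp {s : ℂ} (hs : 1 < s.re) :
    idealZeta K s = Complex.exp (logIdealZeta K s) :=
  hasSum_ideals_eq_exp hs (hasSum_idealZeta hs)

lemma re_log_comb_nonneg {a : ℝ} (ha₀ : 0 ≤ a) (ha₁ : a < 1) {z : ℂ} (hz : ‖z‖ = 1) :
    0 ≤ 3 * (-Complex.log (1 - a)).re + 4 * (-Complex.log (1 - a * z)).re +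
      (-Complex.log (1 - a * z ^ 2)).re := by
  have hac₀ : ‖(a : ℂ)‖ < 1 := by
    simp only [Complex.norm_of_nonneg ha₀, ha₁]
  have hac₁ : ‖a * z‖ < 1 := by rwa [norm_mul, hz, mul_one]
  have hac₂ : ‖a * z ^ 2‖ < 1 := by rwa [norm_mul, norm_pow, hz, one_pow, mul_one]
  rw [← ((Complex.hasSum_re <| Complex.hasSum_taylorSeries_neg_log hac₀).mul_left 3).add
    ((Complex.hasSum_re <| Complex.hasSum_taylorSeries_neg_log hac₁).mul_left 4) |>.add
    (Complex.hasSum_re <| Complex.hasSum_taylorSeries_neg_log hac₂) |>.tsum_eq]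
  refine tsum_nonneg fun n ↦ ?_
  simp only [← Complex.ofReal_pow, Complex.div_natCast_re, Complex.ofReal_re, mul_pow,
    Complex.mul_re, Complex.ofReal_im, zero_mul, sub_zero]
  rcases n.eq_zero_or_pos with rfl | hn
  · simp
  · simp only [← mul_div_assoc, ← add_div]
    refine div_nonneg ?_ n.cast_nonneg
    rw [← pow_mul, pow_mul', sq, Complex.mul_re, ← sq, ← sq, ← Complex.sq_norm_sub_sq_re, norm_pow,
      hz]
    convert! (show 0 ≤ 2 * a ^ n * ((z ^ n).re + 1) ^ 2 by positivity) using 1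
    ring

lemma one_le_norm_idealZeta_prod {x : ℝ} (hx : 0 < x) (t : ℝ) :
    1 ≤ ‖idealZeta K (1 + x) ^ 3 * idealZeta K (1 + t * Complex.I + x) ^ 4 *
      idealZeta K (1 + (2 * t : ℝ) * Complex.I + x)‖ := by
  have h₀ : 1 < (1 + x : ℂ).re := by simpa
  have h₁ : 1 < (1 + t * Complex.I + x : ℂ).re := by simpa
  have h₂ : 1 < (1 + (2 * t : ℝ) * Complex.I + x : ℂ).re := by simpa
  have H₀ := summable_neg_log_one_sub_idealCpow (K := K) h₀
  have H₁ := summable_neg_log_one_sub_idealCpow (K := K) h₁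
  have H₂ := summable_neg_log_one_sub_idealCpow (K := K) h₂
  have hsum₀ := (Complex.hasSum_re H₀.hasSum).summable.mul_left 3
  have hsum₁ := (Complex.hasSum_re H₁.hasSum).summable.mul_left 4
  have hsum₂ := (Complex.hasSum_re H₂.hasSum).summable
  rw [idealZeta_eq_exp h₀, idealZeta_eq_exp h₁, idealZeta_eq_exp h₂]
  simp only [← Complex.exp_nat_mul, Nat.cast_ofNat, ← Complex.exp_add, Complex.norm_exp,
    Complex.add_re, Complex.mul_re, Complex.re_ofNat, Complex.im_ofNat, zero_mul, sub_zero,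
    Real.one_le_exp_iff]
  rw [logIdealZeta, logIdealZeta, logIdealZeta, Complex.re_tsum H₀, Complex.re_tsum H₁,
    Complex.re_tsum H₂, ← tsum_mul_left, ← tsum_mul_left,
    ← hsum₀.tsum_add hsum₁, ← (hsum₀.add hsum₁).tsum_add hsum₂]
  refine tsum_nonneg fun v ↦ ?_
  have hN := two_le_absNorm_heightOneSpectrum v
  have hN0 : (Ideal.absNorm v.asIdeal : ℂ) ≠ 0 := Nat.cast_ne_zero.mpr (by lia)
  have h := re_log_comb_nonneg (a := (Ideal.absNorm v.asIdeal : ℝ) ^ (-(1 + x)))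
    (z := (Ideal.absNorm v.asIdeal : ℂ) ^ (-(t * Complex.I))) (by positivity)
    (Real.rpow_lt_one_of_one_lt_of_neg (by exact_mod_cast hN) (by linarith))
    (by rw [Complex.norm_natCast_cpow_of_pos (by lia)]; simp)
  rw [Complex.ofReal_cpow (Nat.cast_nonneg _), Complex.ofReal_natCast, ← Complex.cpow_nat_mul,
    ← Complex.cpow_add _ _ hN0, ← Complex.cpow_add _ _ hN0] at h
  simp only [idealCpow]
  convert h using 8
  · rfl
  · push_cast
    rfl
  · congr 1
    push_cast
    ring
  · push_cast
    ring

lemma exists_analyticAt_slope {f : ℂ → ℂ} {z : ℂ} (hf : AnalyticAt ℂ f z) (h0 : f z = 0)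
    (h1 : deriv f z ≠ 0) : ∃ g : ℂ → ℂ, AnalyticAt ℂ g z ∧ g z ≠ 0 ∧
      ∀ w, f w = (w - z) * g w := by
  obtain ⟨p, hp⟩ := hf
  refine ⟨dslope f z, ⟨_, hp.has_fpower_series_dslope_fslope⟩, by rwa [dslope_same], fun w ↦ ?_⟩
  rw [← smul_eq_mul, sub_smul_dslope, h0, sub_zero]

lemma differentiable_one_sub_pow_mul_cpow (d m : ℕ) [NeZero m] :
    Differentiable ℂ fun s : ℂ ↦ 1 - (m : ℂ) ^ d * (m : ℂ) ^ (-(d * s)) := fun _ ↦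
  (((((differentiableAt_id.const_mul (d : ℂ)).neg).const_cpow
    (Or.inl (Nat.cast_ne_zero.mpr (NeZero.ne m)))).const_mul _).const_sub _)

lemma deriv_one_sub_pow_mul_cpow_ne_zero {d : ℕ} (hd : d ≠ 0) :
    deriv (fun s : ℂ ↦ 1 - ((2 : ℕ) : ℂ) ^ d * ((2 : ℕ) : ℂ) ^ (-(d * s))) 1 ≠ 0 := by
  have h : HasDerivAt (fun s : ℂ ↦ 1 - ((2 : ℕ) : ℂ) ^ d * ((2 : ℕ) : ℂ) ^ (-(d * s)))
      (-(((2 : ℕ) : ℂ) ^ d * (((2 : ℕ) : ℂ) ^ (-(d * 1 : ℂ)) * Complex.log ((2 : ℕ) : ℂ) *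
        -(d * 1)))) 1 :=
    (((((hasDerivAt_id (1 : ℂ)).const_mul (d : ℂ)).neg).const_cpow
      (Or.inl (by norm_num))).const_mul _).const_sub _
  rw [h.deriv]
  have h2 : Complex.log ((2 : ℕ) : ℂ) ≠ 0 := by
    rw [← Complex.natCast_log]
    exact Complex.ofReal_ne_zero.mpr (Real.log_pos (by norm_num)).ne'
  simpa [hd] using h2

lemma one_sub_pow_mul_cpow_eq_zero_iff {d m : ℕ} [NeZero m] {s : ℂ} :
    1 - (m : ℂ) ^ d * (m : ℂ) ^ (-(d * s)) = 0 ↔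
      ∃ k : ℤ, d * (1 - s) * Real.log m = k * (2 * Real.pi * Complex.I) := by
  have hm : (m : ℂ) ≠ 0 := Nat.cast_ne_zero.mpr (NeZero.ne m)
  rw [← Complex.cpow_natCast, ← Complex.cpow_add _ _ hm, sub_eq_zero, eq_comm,
    Complex.cpow_def_of_ne_zero hm, Complex.exp_eq_one_iff, ← Complex.natCast_log]
  refine exists_congr fun k ↦ ?_
  rw [show (Complex.ofReal (Real.log m)) * (d + -(d * s)) = d * (1 - s) * Real.log m by ring]

lemma log_two_mul_ne_log_three_mul {a b : ℤ} (ha : a ≠ 0) :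
    (b : ℝ) * Real.log 2 ≠ a * Real.log 3 := by
  intro h
  have h1 := congrArg Real.exp h
  rw [mul_comm, mul_comm (a : ℝ), Real.exp_mul, Real.exp_mul, Real.exp_log two_pos,
    Real.exp_log three_pos, Real.rpow_intCast, Real.rpow_intCast] at h1
  have h2 : (2 : ℚ) ^ b = (3 : ℚ) ^ a := by
    rw [← Rat.cast_inj (α := ℝ)]
    push_cast
    exact h1
  have h3 := congrArg (padicValRat 3) h2
  have h4 : padicValRat 3 (2 : ℚ) = 0 := by
    rw [show (2 : ℚ) = ((2 : ℕ) : ℚ) by norm_num, padicValRat.of_nat,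
      padicValNat.eq_zero_of_not_dvd (by norm_num), Nat.cast_zero]
  have h5 : padicValRat 3 (3 : ℚ) = 1 := padicValRat.self (p := 3) (by norm_num)
  rw [padicValRat.zpow, padicValRat.zpow, h4, h5, mul_zero, mul_one] at h3
  exact ha h3.symm

/-- The multiplier is nonzero for `m = 2` or `m = 3`. -/
lemma exists_one_sub_pow_mul_cpow_ne_zero {d : ℕ} (hd : d ≠ 0) {s : ℂ} (hs : s ≠ 1) :
    ∃ m : ℕ, ∃ _ : NeZero m, 1 - (m : ℂ) ^ d * (m : ℂ) ^ (-(d * s)) ≠ 0 := by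
  by_contra! h
  obtain ⟨a, ha⟩ := one_sub_pow_mul_cpow_eq_zero_iff.mp (h 2 ⟨by norm_num⟩)
  obtain ⟨b, hb⟩ := one_sub_pow_mul_cpow_eq_zero_iff.mp (h 3 ⟨by norm_num⟩)
  have hw : (d : ℂ) * (1 - s) ≠ 0 :=
    mul_ne_zero (Nat.cast_ne_zero.mpr hd) (sub_ne_zero.mpr hs.symm)
  have ha0 : a ≠ 0 := by
    rintro rfl
    rw [Int.cast_zero, zero_mul, mul_eq_zero] at ha
    exact ha.elim hw (Complex.ofReal_ne_zero.mpr (Real.log_pos (by norm_num)).ne')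
  refine log_two_mul_ne_log_three_mul (b := b) ha0 ?_
  have h1 : (b : ℂ) * Real.log (2 : ℕ) = a * Real.log (3 : ℕ) := by
    refine mul_left_cancel₀ hw (mul_right_cancel₀ Complex.two_pi_I_ne_zero ?_)
    linear_combination (b * (2 * Real.pi * Complex.I)) * ha - (a * (2 * Real.pi * Complex.I)) * hb
  exact_mod_cast h1

variable (K) in
lemma exists_analyticAt_idealZeta {s₀ : ℂ} (hs₀ : s₀.re = 1) :
    ∃ f : ℂ → ℂ, AnalyticAt ℂ f s₀ ∧
      ∀ᶠ s in 𝓝 s₀, 1 < s.re → (s - 1) * idealZeta K s = f s := by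
  have hd : 0 < (finrank ℚ K : ℝ)⁻¹ := inv_pos.mpr (Nat.cast_pos.mpr finrank_pos)
  have hopen : {s : ℂ | 1 - (finrank ℚ K : ℝ)⁻¹ < s.re} ∈ 𝓝 s₀ :=
    (isOpen_lt continuous_const Complex.continuous_re).mem_nhds (by
      change _ < s₀.re
      linarith)
  have hent (m : ℕ) [NeZero m] : AnalyticAt ℂ
      (fun s : ℂ ↦ 1 - (m : ℂ) ^ finrank ℚ K * (m : ℂ) ^ (-(finrank ℚ K * s))) s₀ :=
    (differentiable_one_sub_pow_mul_cpow _ m).analyticAt _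
  rcases eq_or_ne s₀ 1 with rfl | hne
  · obtain ⟨H, hH, hHs⟩ := exists_differentiableOn_idealZeta (K := K) 2
    obtain ⟨g, hg, hg1, hgs⟩ := exists_analyticAt_slope (hent 2) (by
      rw [mul_one, Complex.cpow_neg, Complex.cpow_natCast, mul_inv_cancel₀ (by simp), sub_self])
      (deriv_one_sub_pow_mul_cpow_ne_zero finrank_pos.ne')
    refine ⟨fun s ↦ H s / g s, (hH.analyticAt hopen).div hg hg1, ?_⟩
    filter_upwards [hg.continuousAt.eventually_ne hg1] with s hs hs1
    rw [eq_div_iff hs, ← hHs s hs1, hgs]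
    ring
  · obtain ⟨m, hm, hne0⟩ := exists_one_sub_pow_mul_cpow_ne_zero
      (finrank_pos (R := ℚ) (M := K)).ne' hne
    obtain ⟨H, hH, hHs⟩ := exists_differentiableOn_idealZeta (K := K) m
    refine ⟨fun s ↦ (s - 1) * H s / (1 - (m : ℂ) ^ finrank ℚ K * (m : ℂ) ^ (-(finrank ℚ K * s))),
      ((analyticAt_id.sub analyticAt_const).mul (hH.analyticAt hopen)).div (hent m) hne0, ?_⟩
    filter_upwards [(hent m).continuousAt.eventually_ne hne0] with s hs hs1
    rw [eq_div_iff hs, ← hHs s hs1]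
    ring

end LocalZeta

section Nonvanishing

open NumberField IsDedekindDomain Module nonZeroDivisors

variable {K : Type*} [Field K] [NumberField K]

lemma analyticAt_ne_zero_of_eq_idealZeta_one {f : ℂ → ℂ} (hf : AnalyticAt ℂ f 1)
    (h : ∀ᶠ s in 𝓝 1, 1 < s.re → (s - 1) * idealZeta K s = f s) : f 1 ≠ 0 := by
  have h1 : Tendsto (fun x : ℝ ↦ (x : ℂ)) (𝓝[>] 1) (𝓝 (1 : ℂ)) := by
    have := (Complex.continuous_ofReal.tendsto 1).mono_left (nhdsWithin_le_nhds (s := Set.Ioi 1))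
    rwa [Complex.ofReal_one] at this
  have h2 : Tendsto (fun x : ℝ ↦ f x) (𝓝[>] 1) (𝓝 (dedekindZeta_residue K)) := by
    refine (tendsto_sub_one_mul_dedekindZeta_nhdsGT K).congr' ?_
    filter_upwards [h1.eventually h, self_mem_nhdsWithin] with x hx hx1
    rw [dedekindZeta_eq_idealZeta (by simpa using hx1)]
    exact hx (by simpa using hx1)
  rw [tendsto_nhds_unique (hf.continuousAt.tendsto.comp h1) h2]
  exact Complex.ofReal_ne_zero.mpr (dedekindZeta_residue_ne_zero K)

/-- The extension of `(s - 1) ζ_K(s)` does not vanish on the line `Re s = 1`. -/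
lemma analyticAt_ne_zero_of_eq_idealZeta {f : ℂ → ℂ} {s₀ : ℂ} (hs₀ : s₀.re = 1)
    (hf : AnalyticAt ℂ f s₀)
    (h : ∀ᶠ s in 𝓝 s₀, 1 < s.re → (s - 1) * idealZeta K s = f s) : f s₀ ≠ 0 := by
  rcases eq_or_ne s₀ 1 with rfl | hne
  · exact analyticAt_ne_zero_of_eq_idealZeta_one hf h
  intro h0
  obtain ⟨t, rfl⟩ : ∃ t : ℝ, s₀ = 1 + t * Complex.I :=
    ⟨s₀.im, Complex.ext (by simp [hs₀]) (by simp)⟩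
  have ht : t ≠ 0 := by
    rintro rfl
    simp at hne
  obtain ⟨f₁, hf₁, h₁⟩ := exists_analyticAt_idealZeta K (s₀ := 1) rfl
  obtain ⟨f₂, hf₂, h₂⟩ := exists_analyticAt_idealZeta K (s₀ := 1 + (2 * t : ℝ) * Complex.I) (by simp)
  have hlim (z : ℂ) : Tendsto (fun x : ℝ ↦ z + x) (𝓝[>] 0) (𝓝 z) := by
    have : Continuous fun x : ℝ ↦ z + x := by fun_prop
    simpa using (this.tendsto 0).mono_left (nhdsWithin_le_nhds (s := Set.Ioi 0))
  obtain ⟨p, hp⟩ := id hf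
  have hg : ContinuousAt (dslope f (1 + t * Complex.I)) (1 + t * Complex.I) :=
    hp.has_fpower_series_dslope_fslope.continuousAt
  have hfg (w : ℂ) : f w = (w - (1 + t * Complex.I)) * dslope f (1 + t * Complex.I) w := by
    rw [← smul_eq_mul, sub_smul_dslope, h0, sub_zero]
  have hx0 : Tendsto (fun x : ℝ ↦ (x : ℂ)) (𝓝[>] 0) (𝓝 0) := by simpa using hlim 0
  have hT := (((((hf₁.continuousAt.tendsto.comp (hlim _)).pow 3).mul
    ((hg.tendsto.comp (hlim _)).pow 4)).mul (hf₂.continuousAt.tendsto.comp (hlim _))).mul hx0).norm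
  rw [mul_zero, norm_zero] at hT
  have hpos : 0 < |t| ^ 4 * |2 * t| := by positivity
  obtain ⟨x, hx, hx1, hx2, hx3, hx4⟩ := ((hT.eventually_lt_const hpos).and
    (((hlim _).eventually h₁).and (((hlim _).eventually h).and (((hlim _).eventually h₂).and
    (self_mem_nhdsWithin : ∀ᶠ x : ℝ in 𝓝[>] 0, x ∈ Set.Ioi 0))))).exists
  have e1 := hx1 (by simpa)
  have e2 := hx2 (by simpa)
  have e3 := hx3 (by simpa)
  refine hx.not_ge ?_
  have hxc : (x : ℂ) ≠ 0 := Complex.ofReal_ne_zero.mpr hx4.ne'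
  simp only [Function.comp_apply]
  have hprod : f₁ (1 + x) ^ 3 * dslope f (1 + t * Complex.I) (1 + t * Complex.I + x) ^ 4 *
      f₂ (1 + (2 * t : ℝ) * Complex.I + x) * x =
      (x + t * Complex.I) ^ 4 * (x + (2 * t : ℝ) * Complex.I) *
        (idealZeta K (1 + x) ^ 3 * idealZeta K (1 + t * Complex.I + x) ^ 4 *
          idealZeta K (1 + (2 * t : ℝ) * Complex.I + x)) := by
    refine mul_right_cancel₀ (pow_ne_zero 3 hxc) ?_
    have e4 := hfg (1 + t * Complex.I + x)
    rw [← e2, add_sub_cancel_left] at e4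
    rw [← e1, ← e3]
    linear_combination (-(x : ℂ) ^ 3 * idealZeta K (1 + x) ^ 3 *
      (x + (2 * t : ℝ) * Complex.I) * idealZeta K (1 + (2 * t : ℝ) * Complex.I + x)) *
      congrArg (· ^ 4) e4
  rw [hprod, norm_mul]
  refine le_trans ?_ (le_mul_of_one_le_right (norm_nonneg _) (one_le_norm_idealZeta_prod hx4 t))
  rw [norm_mul, norm_pow]
  have him (u : ℝ) : |u| ≤ ‖(x + u * Complex.I : ℂ)‖ := by
    simpa using Complex.abs_im_le_norm (x + u * Complex.I)
  gcongr
  · exact him t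
  · exact him _

end Nonvanishing

section Boundary

open NumberField IsDedekindDomain

variable (K : Type*) [Field K] [NumberField K]

variable {K} in
lemma differentiable_idealCpow {I : Ideal (𝓞 K)} (hI : I ≠ ⊥) :
    Differentiable ℂ fun s ↦ idealCpow s I := by
  have h : (Ideal.absNorm I : ℂ) ≠ 0 := by simpa [Ideal.absNorm_eq_zero_iff] using hI
  intro s
  exact differentiableAt_id.neg.const_cpow (Or.inl h)

variable {K} in
lemma norm_idealCpow_le_norm_idealCpow {s t : ℂ} (h : t.re ≤ s.re)
    (v : HeightOneSpectrum (𝓞 K)) :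
    ‖idealCpow s v.asIdeal‖ ≤ ‖idealCpow t v.asIdeal‖ := by
  rw [norm_idealCpow s v.ne_bot, norm_idealCpow t v.ne_bot]
  refine Real.rpow_le_rpow_of_exponent_le ?_ (neg_le_neg h)
  exact_mod_cast one_le_two.trans (two_le_absNorm_heightOneSpectrum v)

variable {K} in
lemma norm_idealCpow_le_half {s : ℂ} (hs : 1 ≤ s.re) (v : HeightOneSpectrum (𝓞 K)) :
    ‖idealCpow s v.asIdeal‖ ≤ 1 / 2 := by
  refine (norm_idealCpow_le_norm_idealCpow (t := 1) (by simpa using hs) v).trans ?_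
  have h2 : (2 : ℝ) ≤ Ideal.absNorm v.asIdeal := by
    exact_mod_cast two_le_absNorm_heightOneSpectrum v
  rw [norm_idealCpow _ v.ne_bot, Complex.one_re, Real.rpow_neg_one, one_div]
  gcongr

variable {K} in
lemma norm_neg_log_one_sub_idealCpow_sub_le {s : ℂ} (hs : 1 ≤ s.re)
    (v : HeightOneSpectrum (𝓞 K)) :
    ‖-Complex.log (1 - idealCpow s v.asIdeal) - idealCpow s v.asIdeal‖ ≤
      ‖idealCpow (2 : ℂ) v.asIdeal‖ := by
  have hle := norm_idealCpow_le_half hs v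
  have h := Complex.norm_log_one_add_sub_self_le (z := -idealCpow s v.asIdeal)
    (by rw [norm_neg]; linarith)
  rw [norm_neg] at h
  rw [show -Complex.log (1 - idealCpow s v.asIdeal) - idealCpow s v.asIdeal =
    -(Complex.log (1 + -idealCpow s v.asIdeal) - -idealCpow s v.asIdeal) by ring_nf, norm_neg]
  refine h.trans ?_
  have h1 : (1 - ‖idealCpow s v.asIdeal‖)⁻¹ ≤ 2 := by
    rw [inv_le_comm₀ (by linarith) two_pos]; linarith
  have h2 : ‖idealCpow s v.asIdeal‖ ^ 2 ≤ ‖idealCpow (2 : ℂ) v.asIdeal‖ := by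
    calc ‖idealCpow s v.asIdeal‖ ^ 2 ≤ ‖idealCpow (1 : ℂ) v.asIdeal‖ ^ 2 := by
          gcongr
          exact norm_idealCpow_le_norm_idealCpow (by simpa using hs) v
      _ = _ := by
          rw [norm_idealCpow _ v.ne_bot, norm_idealCpow _ v.ne_bot, ← Real.rpow_mul_natCast
            (Nat.cast_nonneg _)]
          norm_num
  nlinarith [sq_nonneg ‖idealCpow s v.asIdeal‖]

lemma continuousOn_tsum_neg_log_one_sub_idealCpow_sub :
    ContinuousOn (fun s ↦ ∑' v : HeightOneSpectrum (𝓞 K),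
      (-Complex.log (1 - idealCpow s v.asIdeal) - idealCpow s v.asIdeal)) {s | 1 ≤ s.re} := by
  refine continuousOn_tsum (fun v ↦ ?_)
    (summable_idealCpow_heightOneSpectrum (K := K) (s := 2) (by norm_num)).norm
    (fun v s hs ↦ norm_neg_log_one_sub_idealCpow_sub_le hs v)
  have hc := (differentiable_idealCpow v.ne_bot).continuous.continuousOn (s := {s : ℂ | 1 ≤ s.re})
  refine ((ContinuousOn.clog (continuousOn_const.sub hc) fun s hs ↦ ?_).neg).sub hc
  left
  have h1 := norm_idealCpow_le_half hs v
  have h2 := Complex.re_le_norm (idealCpow s v.asIdeal)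
  rw [Pi.sub_apply, Complex.sub_re, Complex.one_re]
  linarith

lemma continuousOn_tsum_idealCpow_heightOneSpectrum :
    ContinuousOn (fun s ↦ ∑' v : HeightOneSpectrum (𝓞 K), idealCpow s v.asIdeal)
      {s | 1 < s.re} := by
  intro s₀ hs₀
  obtain ⟨σ, h1, h2⟩ := exists_between (show 1 < s₀.re from hs₀)
  have hU : {s : ℂ | σ < s.re} ∈ 𝓝 s₀ :=
    (isOpen_lt continuous_const Complex.continuous_re).mem_nhds h2
  refine ContinuousAt.continuousWithinAt (ContinuousOn.continuousAt ?_ hU)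
  exact continuousOn_tsum (fun v ↦ (differentiable_idealCpow v.ne_bot).continuous.continuousOn)
    (summable_idealCpow_heightOneSpectrum (K := K) (s := σ) (by simpa using h1)).norm
    (fun v s hs ↦ norm_idealCpow_le_norm_idealCpow (by simpa using le_of_lt hs) v)

variable {K} in
lemma logIdealZeta_eq_add {s : ℂ} (hs : 1 < s.re) :
    logIdealZeta K s = (∑' v : HeightOneSpectrum (𝓞 K), idealCpow s v.asIdeal) +
      ∑' v : HeightOneSpectrum (𝓞 K),
        (-Complex.log (1 - idealCpow s v.asIdeal) - idealCpow s v.asIdeal) := by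
  have h1 := summable_idealCpow_heightOneSpectrum (K := K) hs
  have h2 := summable_neg_log_one_sub_idealCpow (K := K) hs
  rw [← h1.tsum_add (h2.sub h1), logIdealZeta]
  exact tsum_congr fun v ↦ by ring

lemma continuousOn_logIdealZeta : ContinuousOn (logIdealZeta K) {s | 1 < s.re} :=
  ((continuousOn_tsum_idealCpow_heightOneSpectrum K).add
    ((continuousOn_tsum_neg_log_one_sub_idealCpow_sub K).mono
      fun _ hs ↦ le_of_lt (Set.mem_ofPred.mp hs))).congr
    fun _ hs ↦ logIdealZeta_eq_add hs

lemma exists_tendsto_logIdealZeta_add_log {s₀ : ℂ} (hs₀ : s₀.re = 1) :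
    ∃ l, Tendsto (fun s ↦ logIdealZeta K s + Complex.log (s - 1)) (𝓝[{s | 1 < s.re}] s₀)
      (𝓝 l) := by
  obtain ⟨f, hf, h⟩ := exists_analyticAt_idealZeta (K := K) hs₀
  have hf0 : f s₀ ≠ 0 := analyticAt_ne_zero_of_eq_idealZeta hs₀ hf h
  have hdiv : ∀ᶠ s in 𝓝 s₀, f s / f s₀ ∈ Complex.slitPlane := by
    refine (hf.continuousAt.div_const _).eventually_mem ?_
    rw [div_self hf0]
    exact Complex.isOpen_slitPlane.mem_nhds Complex.one_mem_slitPlane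
  obtain ⟨r, hr, hball⟩ := Metric.eventually_nhds_iff_ball.mp
    (h.and (hdiv.and hf.eventually_analyticAt))
  set W : Set ℂ := Metric.ball s₀ r ∩ {s | 1 < s.re} with hW
  have hWpre : IsPreconnected W :=
    ((convex_ball s₀ r).inter (convex_halfSpace_re_gt 1)).isPreconnected
  let L : ℂ → ℂ := fun s ↦ Complex.log (f s / f s₀) + Complex.log (f s₀)
  let D : ℂ → ℂ := fun s ↦ logIdealZeta K s + Complex.log (s - 1) - L s
  have hL : ∀ s ∈ Metric.ball s₀ r, ContinuousAt L s := fun s hs ↦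
    (((hball s hs).2.2.continuousAt.div_const _).clog (hball s hs).2.1).add_const _
  have hDc : ContinuousOn D W := by
    refine (((continuousOn_logIdealZeta K).mono Set.inter_subset_right).add ?_).sub
      fun s hs ↦ (hL s hs.1).continuousWithinAt
    refine ContinuousOn.clog (by fun_prop) fun s hs ↦ Or.inl ?_
    simpa using hs.2
  have hDm : Set.MapsTo D W (AddSubgroup.zmultiples (2 * Real.pi * Complex.I : ℂ)) := by
    intro s hs
    have hs1 : s - 1 ≠ 0 := by
      intro h0
      have := hs.2
      rw [sub_eq_zero.mp h0] at this
      simp at this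
    have hfs : f s / f s₀ ≠ 0 := Complex.slitPlane_ne_zero (hball s hs.1).2.1
    have hexp : Complex.exp (D s) = 1 := by
      simp only [D, L]
      rw [Complex.exp_sub, Complex.exp_add, Complex.exp_add, Complex.exp_log hs1,
        Complex.exp_log hfs, Complex.exp_log hf0, ← idealZeta_eq_exp hs.2, mul_comm,
        (hball s hs.1).1 hs.2, div_mul_cancel₀ _ hf0, div_self]
      exact (div_ne_zero_iff.mp hfs).1
    obtain ⟨m, hm⟩ := Complex.exp_eq_one_iff.mp hexp
    exact ⟨m, by simp [hm]⟩
  have hdisc : IsDiscrete (AddSubgroup.zmultiples (2 * Real.pi * Complex.I : ℂ) : Set ℂ) :=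
    ⟨NormedSpace.discreteTopology_zmultiples _⟩
  obtain ⟨c, -, hc⟩ := hWpre.eqOn_const_of_mapsTo hdisc hDc hDm ⟨0, zero_mem _⟩
  refine ⟨L s₀ + c, ?_⟩
  have hT : Tendsto (fun s ↦ L s + c) (𝓝[{s | 1 < s.re}] s₀) (𝓝 (L s₀ + c)) :=
    ((hL s₀ (Metric.mem_ball_self hr)).tendsto.mono_left nhdsWithin_le_nhds).add_const c
  refine hT.congr' ?_
  filter_upwards [self_mem_nhdsWithin, mem_nhdsWithin_of_mem_nhds (Metric.ball_mem_nhds s₀ hr)]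
    with s hs hs'
  have := hc ⟨hs', hs⟩
  simp only [D, Function.const_apply] at this
  rw [← this]
  ring

end Boundary

section Splitting

open NumberField IsDedekindDomain Module

variable {K : Type*} [Field K] [NumberField K]

lemma card_absNorm_eq_of_mem_splitCompletelySet {n p : ℕ} (hp : p ∈ splitCompletelySet K n) :
    Nat.card {v : HeightOneSpectrum (𝓞 K) // Ideal.absNorm v.asIdeal = p} = n := by
  obtain ⟨hpp, T, hT, hprime, hnorm, hprod⟩ := hp
  have hne (P : T) : (P : Ideal (𝓞 K)) ≠ ⊥ := by
    intro h
    have := hnorm P P.2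
    rw [h, Ideal.absNorm_bot] at this
    exact hpp.ne_zero this.symm
  let e : T → {v : HeightOneSpectrum (𝓞 K) // Ideal.absNorm v.asIdeal = p} :=
    fun P ↦ ⟨⟨P, hprime P P.2, hne P⟩, hnorm P P.2⟩
  have he : Function.Bijective e := by
    constructor
    · intro P Q h
      have := congrArg (fun w ↦ w.1.asIdeal) h
      exact Subtype.ext this
    · rintro ⟨v, hv⟩
      have hmem : (p : 𝓞 K) ∈ v.asIdeal := by
        have := Ideal.absNorm_mem v.asIdeal
        rwa [hv] at this
      have hle : ∏ P ∈ T, P ≤ v.asIdeal := by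
        rw [← hprod, Ideal.span_singleton_le_iff_mem]
        exact hmem
      obtain ⟨P, hP, hPv⟩ := (Ideal.IsPrime.prod_le v.isPrime).mp hle
      have hmax : P.IsMaximal := (hprime P hP).isMaximal (hne ⟨P, hP⟩)
      refine ⟨⟨P, hP⟩, Subtype.ext (HeightOneSpectrum.ext ?_)⟩
      exact hmax.eq_of_le v.isPrime.ne_top hPv
  rw [← Nat.card_congr (Equiv.ofBijective e he), Nat.card_eq_fintype_card, Fintype.card_coe, hT]

/-- The rational prime below a prime of a number field. -/
noncomputable def primeBelow (v : HeightOneSpectrum (𝓞 K)) : ℕ :=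
  Ideal.absNorm (v.asIdeal.under ℤ)

omit [NumberField K] in
lemma prime_primeBelow (v : HeightOneSpectrum (𝓞 K)) : (primeBelow v).Prime := by
  have := v.isPrime
  have : NeZero v.asIdeal := ⟨v.ne_bot⟩
  exact Nat.absNorm_under_prime v.asIdeal

instance liesOver_primeBelow (v : HeightOneSpectrum (𝓞 K)) :
    v.asIdeal.LiesOver (Ideal.span {(primeBelow v : ℤ)}) :=
  Int.liesOver_span_absNorm v.asIdeal

lemma isMaximal_span_natCast {p : ℕ} (hp : p.Prime) : (Ideal.span {(p : ℤ)}).IsMaximal :=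
  PrincipalIdealRing.isMaximal_of_irreducible (Nat.prime_iff_prime_int.mp hp).irreducible

lemma absNorm_eq_primeBelow_pow (v : HeightOneSpectrum (𝓞 K)) :
    Ideal.absNorm v.asIdeal = primeBelow v ^ v.asIdeal.inertiaDeg ℤ := by
  have := isMaximal_span_natCast (prime_primeBelow v)
  have := v.isMaximal
  rw [← Ideal.inertiaDeg'_eq_inertiaDeg (Ideal.span {(primeBelow v : ℤ)}) v.asIdeal]
  exact Ideal.absNorm_eq_pow_inertiaDeg' v.asIdeal (prime_primeBelow v)

lemma ncard_primesOver_le [IsGalois ℚ K] {p : ℕ} (hp : p.Prime) :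
    ((Ideal.span {(p : ℤ)}).primesOver (𝓞 K)).ncard ≤ finrank ℚ K := by
  have := isMaximal_span_natCast hp
  have h := Ideal.ncard_primesOver_mul_ramificationIdxIn_mul_inertiaDegIn
    (Ideal.span {(p : ℤ)}) (𝓞 K) Gal(K/ℚ)
  rw [IsGaloisGroup.card_eq_finrank Gal(K/ℚ) ℚ K] at h
  exact Nat.le_of_dvd finrank_pos ⟨_, h.symm⟩

lemma primeBelow_mem_splitCompletelySet [IsGalois ℚ K] {v : HeightOneSpectrum (𝓞 K)}
    (hd : ¬ (primeBelow v : ℤ) ∣ discr K) (hf : v.asIdeal.inertiaDeg ℤ = 1) :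
    primeBelow v ∈ splitCompletelySet K (finrank ℚ K) := by
  set p := primeBelow v with hp
  have hpp : p.Prime := prime_primeBelow v
  have hpz := Nat.prime_iff_prime_int.mp hpp
  have hmax := isMaximal_span_natCast hpp
  have hv := v.isPrime
  have hne : Ideal.span {(p : ℤ)} ≠ 0 := by simpa using hpp.ne_zero
  have hfin : ((Ideal.span {(p : ℤ)}).primesOver (𝓞 K)).Finite :=
    Algebra.QuasiFinite.finite_primesOver _
  have hunr := (not_dvd_discr_iff_forall_mem K (𝓞 K) hpz).mp hd
  have hram (P : Ideal (𝓞 K)) (hP : P ∈ (Ideal.span {(p : ℤ)}).primesOver (𝓞 K)) :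
      P.ramificationIdx ℤ = 1 := by
    have := hP.1
    exact Ideal.ramificationIdx_eq_one_iff.mpr (hunr P hP.1
      ((Ideal.liesOver_span_iff hP.1.ne_top hpz).mp hP.2))
  have hIn : (Ideal.span {(p : ℤ)}).inertiaDegIn (𝓞 K) = 1 := by
    rw [Ideal.inertiaDegIn_eq_inertiaDeg _ v.asIdeal Gal(K/ℚ), hf]
  have hRn : (Ideal.span {(p : ℤ)}).ramificationIdxIn (𝓞 K) = 1 := by
    rw [Ideal.ramificationIdxIn_eq_ramificationIdx _ v.asIdeal Gal(K/ℚ)]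
    exact hram _ ⟨v.isPrime, inferInstance⟩
  have hcard := Ideal.ncard_primesOver_mul_ramificationIdxIn_mul_inertiaDegIn
    (Ideal.span {(p : ℤ)}) (𝓞 K) Gal(K/ℚ)
  rw [IsGaloisGroup.card_eq_finrank Gal(K/ℚ) ℚ K, hIn, hRn, mul_one, mul_one] at hcard
  refine ⟨hpp, hfin.toFinset, ?_, fun P hP ↦ (hfin.mem_toFinset.mp hP).1, fun P hP ↦ ?_, ?_⟩
  · rw [← hcard, Set.ncard_eq_toFinset_card _ hfin]
  · obtain ⟨h1, h2⟩ := hfin.mem_toFinset.mp hP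
    have hPm : P.IsMaximal := Ideal.IsMaximal.of_liesOver_isMaximal P (Ideal.span {(p : ℤ)})
    rw [Ideal.absNorm_eq_pow_inertiaDeg' P hpp, Ideal.inertiaDeg'_eq_inertiaDeg,
      ← Ideal.inertiaDegIn_eq_inertiaDeg (Ideal.span {(p : ℤ)}) P Gal(K/ℚ), hIn, pow_one]
  · have h := Ideal.map_algebraMap_eq_finsetProd_pow (R := 𝓞 K) hne
    rw [Ideal.map_span, Set.image_singleton, algebraMap_int_eq, eq_intCast, Int.cast_natCast] at h
    rw [h]
    refine Finset.prod_congr (by ext; simp) fun P hP ↦ ?_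
    rw [hram P (hfin.mem_toFinset.mp hP), pow_one]

lemma summable_primeBelow [IsGalois ℚ K] :
    Summable fun v : HeightOneSpectrum (𝓞 K) ↦ ((primeBelow v : ℝ) ^ 2)⁻¹ := by
  classical
  have hs : Summable fun m : ℕ ↦ ((m : ℝ) ^ 2)⁻¹ := Real.summable_nat_pow_inv.mpr one_lt_two
  refine summable_of_sum_le (c := finrank ℚ K * ∑' m : ℕ, ((m : ℝ) ^ 2)⁻¹)
    (fun v ↦ by positivity) fun u ↦ ?_
  rw [Finset.sum_comp (fun m : ℕ ↦ ((m : ℝ) ^ 2)⁻¹) primeBelow]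
  calc ∑ m ∈ u.image primeBelow, (u.filter (primeBelow · = m)).card • ((m : ℝ) ^ 2)⁻¹
      ≤ ∑ m ∈ u.image primeBelow, finrank ℚ K * ((m : ℝ) ^ 2)⁻¹ := by
        refine Finset.sum_le_sum fun m hm ↦ ?_
        obtain ⟨w, -, rfl⟩ := Finset.mem_image.mp hm
        rw [nsmul_eq_mul]
        gcongr
        refine le_trans ?_ (ncard_primesOver_le (K := K) (prime_primeBelow w))
        have := isMaximal_span_natCast (prime_primeBelow w)
        have hfin : ((Ideal.span {(primeBelow w : ℤ)}).primesOver (𝓞 K)).Finite :=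
          Algebra.QuasiFinite.finite_primesOver _
        rw [Set.ncard_eq_toFinset_card _ hfin]
        refine Finset.card_le_card_of_injOn (fun v ↦ v.asIdeal) (fun v hv ↦ ?_)
          fun v _ v' _ h ↦ HeightOneSpectrum.ext h
        have hv' : primeBelow v = primeBelow w := (Finset.mem_filter.mp hv).2
        rw [Set.Finite.coe_toFinset, ← hv']
        exact ⟨v.isPrime, inferInstance⟩
    _ = finrank ℚ K * ∑ m ∈ u.image primeBelow, ((m : ℝ) ^ 2)⁻¹ := by rw [Finset.mul_sum]
    _ ≤ _ := by
        gcongr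
        exact hs.sum_le_tsum _ fun _ _ ↦ by positivity

lemma norm_idealCpow_one_le [IsGalois ℚ K] {v : HeightOneSpectrum (𝓞 K)}
    (hv : Ideal.absNorm v.asIdeal ∉ splitCompletelySet K (finrank ℚ K)) :
    ‖idealCpow 1 v.asIdeal‖ ≤ (discr K : ℝ) ^ 2 * ((primeBelow v : ℝ) ^ 2)⁻¹ := by
  have hp : (0 : ℝ) < primeBelow v := by exact_mod_cast (prime_primeBelow v).pos
  rw [norm_idealCpow _ v.ne_bot, Complex.one_re, Real.rpow_neg_one]
  by_cases hd : (primeBelow v : ℤ) ∣ discr K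
  · have h1 : (primeBelow v : ℝ) ≤ |(discr K : ℝ)| := by
      exact_mod_cast Int.le_of_dvd (abs_pos.mpr (discr_ne_zero K)) ((dvd_abs _ _).mpr hd)
    have h2 : (1 : ℝ) ≤ Ideal.absNorm v.asIdeal := by
      exact_mod_cast one_le_two.trans (two_le_absNorm_heightOneSpectrum v)
    refine (inv_le_one_of_one_le₀ h2).trans ?_
    rw [← div_eq_mul_inv, one_le_div (by positivity), ← sq_abs (discr K : ℝ)]
    gcongr
  · have h1 : (1 : ℝ) ≤ (discr K : ℝ) ^ 2 := by
      have : 0 < discr K ^ 2 := sq_pos_of_ne_zero (discr_ne_zero K)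
      exact_mod_cast this
    refine le_trans ?_ (le_mul_of_one_le_left (by positivity) h1)
    have hf : 2 ≤ v.asIdeal.inertiaDeg ℤ := by
      by_contra! hlt
      have h2 := two_le_absNorm_heightOneSpectrum v
      have h3 := absNorm_eq_primeBelow_pow v
      interval_cases hi : v.asIdeal.inertiaDeg ℤ
      · rw [pow_zero] at h3; omega
      · rw [pow_one] at h3
        exact hv (h3 ▸ primeBelow_mem_splitCompletelySet hd hi)
    rw [absNorm_eq_primeBelow_pow, Nat.cast_pow]
    have : (1 : ℝ) ≤ primeBelow v := by exact_mod_cast (prime_primeBelow v).one_le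
    gcongr

variable (K) in
lemma continuousOn_tsum_idealCpow_not_split [IsGalois ℚ K] :
    ContinuousOn (fun s ↦ ∑' v : ({v : HeightOneSpectrum (𝓞 K) |
      Ideal.absNorm v.asIdeal ∈ splitCompletelySet K (finrank ℚ K)}ᶜ : Set _),
        idealCpow s v.1.asIdeal) {s | 1 ≤ s.re} := by
  refine continuousOn_tsum
    (fun v ↦ (differentiable_idealCpow v.1.ne_bot).continuous.continuousOn)
    ((summable_primeBelow (K := K)).subtype _ |>.mul_left ((discr K : ℝ) ^ 2)) fun v s hs ↦ ?_
  exact (norm_idealCpow_le_norm_idealCpow (t := 1) (by simpa using hs) v.1).trans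
    (norm_idealCpow_one_le v.2)

lemma tsum_idealCpow_split {n : ℕ} {s : ℂ} (hs : 1 < s.re) :
    ∑' v : {v : HeightOneSpectrum (𝓞 K) | Ideal.absNorm v.asIdeal ∈ splitCompletelySet K n},
      idealCpow s v.1.asIdeal = n * ∑' p : splitCompletelySet K n, ((p : ℕ) : ℂ) ^ (-s) := by
  have hsum : Summable fun v : {v : HeightOneSpectrum (𝓞 K) |
      Ideal.absNorm v.asIdeal ∈ splitCompletelySet K n} ↦ idealCpow s v.1.asIdeal :=
    (summable_idealCpow_heightOneSpectrum (K := K) hs).subtype _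
  let φ : {v : HeightOneSpectrum (𝓞 K) | Ideal.absNorm v.asIdeal ∈ splitCompletelySet K n} →
      splitCompletelySet K n := fun v ↦ ⟨Ideal.absNorm v.1.asIdeal, v.2⟩
  rw [← (hsum.hasSum.tsum_fiberwise φ).tsum_eq, ← tsum_mul_left]
  refine tsum_congr fun p ↦ ?_
  have hc : ∀ v : φ ⁻¹' {p}, idealCpow s v.1.1.asIdeal = ((p : ℕ) : ℂ) ^ (-s) := by
    rintro ⟨v, rfl⟩
    rfl
  rw [tsum_congr hc, tsum_const, nsmul_eq_mul]
  congr 2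
  refine Eq.trans ?_ (card_absNorm_eq_of_mem_splitCompletelySet p.2)
  refine Nat.card_congr ⟨fun v ↦ ⟨v.1.1, congrArg Subtype.val v.2⟩,
    fun v ↦ ⟨⟨v.1, ?_⟩, Subtype.ext v.2⟩, fun _ ↦ rfl, fun _ ↦ rfl⟩
  simp [v.2]

end Splitting

section PrimeSum

open NumberField IsDedekindDomain Module

variable {S : Set ℕ}

lemma summable_norm_prime_cpow (hS : ∀ p ∈ S, p.Prime) {s : ℂ} (hs : 1 < s.re) :
    Summable fun p : S ↦ ‖((p : ℕ) : ℂ) ^ (-s)‖ := by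
  refine ((Real.summable_nat_rpow.mpr (neg_lt_neg hs)).subtype S).congr fun p : S ↦ ?_
  rw [Complex.norm_natCast_cpow_of_pos (hS p p.2).pos, Complex.neg_re]
  rfl

lemma differentiableOn_tsum_prime_cpow (hS : ∀ p ∈ S, p.Prime) :
    DifferentiableOn ℂ (fun s : ℂ ↦ ∑' p : S, ((p : ℕ) : ℂ) ^ (-s)) {s : ℂ | 1 < s.re} := by
  intro s₀ hs₀
  obtain ⟨σ, h1, h2⟩ := exists_between (show 1 < s₀.re from hs₀)
  have hU : IsOpen {s : ℂ | σ < s.re} := isOpen_lt continuous_const Complex.continuous_re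
  refine DifferentiableAt.differentiableWithinAt
    (DifferentiableOn.differentiableAt ?_ (hU.mem_nhds h2))
  refine Complex.differentiableOn_tsum_of_summable_norm
    (summable_norm_prime_cpow hS (s := σ) (by simpa using h1)) (fun p s _ ↦ ?_) hU
    fun p s hs ↦ ?_
  · have hp : ((p : ℕ) : ℂ) ≠ 0 := by exact_mod_cast (hS p p.2).ne_zero
    exact (differentiableAt_id.neg.const_cpow (Or.inl hp)).differentiableWithinAt
  · rw [Complex.norm_natCast_cpow_of_pos (hS p p.2).pos,
      Complex.norm_natCast_cpow_of_pos (hS p p.2).pos]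
    refine Real.rpow_le_rpow_of_exponent_le (by exact_mod_cast (hS p p.2).one_le) ?_
    simpa using le_of_lt hs

lemma ofReal_tsum_prime_rpow (z : ℝ) :
    ((∑' p : S, ((p : ℕ) : ℝ) ^ (-z) : ℝ) : ℂ) = ∑' p : S, ((p : ℕ) : ℂ) ^ (-(z : ℂ)) := by
  rw [Complex.ofReal_tsum]
  refine tsum_congr fun p ↦ ?_
  rw [Complex.ofReal_cpow (Nat.cast_nonneg _), Complex.ofReal_natCast, Complex.ofReal_neg]

lemma log_one_div_sub_one {z : ℂ} (hz : 1 < z.re) :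
    Complex.log (1 / (z - 1)) = -Complex.log (z - 1) := by
  have hre : 0 < (z - 1).re := by simpa using hz
  rw [one_div, Complex.log_inv]
  intro h
  have := Complex.abs_arg_lt_pi_div_two_iff.mpr (Or.inl hre)
  rw [h, abs_of_pos Real.pi_pos] at this
  linarith [Real.pi_pos]

lemma closure_one_lt_re : closure {z : ℂ | 1 < z.re} = {z | 1 ≤ z.re} :=
  Complex.closure_setOfPred_lt_re 1

/-- Weak regularity follows from the existence of limits on the line `re z = 1`. -/
lemma exists_weaklyRegular_of_tendsto (hS : ∀ p ∈ S, p.Prime) (a : ℂ)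
    (h : ∀ s₀ : ℂ, s₀.re = 1 → ∃ l, Tendsto
      (fun s : ℂ ↦ ∑' p : S, ((p : ℕ) : ℂ) ^ (-s) + a * Complex.log (s - 1))
      (𝓝[{s | 1 < s.re}] s₀) (𝓝 l)) :
    ∃ g : ℂ → ℂ, DifferentiableOn ℂ g {z : ℂ | 1 < z.re} ∧
      ContinuousOn g {z : ℂ | 1 ≤ z.re} ∧
      ∀ z : ℂ, 1 < z.re →
        (∑' p : S, ((p : ℕ) : ℂ) ^ (-z)) = a * Complex.log (1 / (z - 1)) + g z := by
  set F : ℂ → ℂ := fun s ↦ ∑' p : S, ((p : ℕ) : ℂ) ^ (-s) + a * Complex.log (s - 1) with hF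
  have hd : DifferentiableOn ℂ F {z : ℂ | 1 < z.re} := by
    refine (differentiableOn_tsum_prime_cpow hS).add (DifferentiableOn.const_mul ?_ a)
    refine DifferentiableOn.clog (by fun_prop) fun z hz ↦ Or.inl ?_
    simpa using hz
  have heq : ∀ z ∈ {z : ℂ | 1 < z.re}, extendFrom {z : ℂ | 1 < z.re} F z = F z := fun z hz ↦
    extendFrom_eq (subset_closure hz) (hd.continuousOn z hz)
  refine ⟨extendFrom {z : ℂ | 1 < z.re} F, hd.congr heq, ?_, fun z hz ↦ ?_⟩
  · refine continuousOn_extendFrom closure_one_lt_re.ge fun z hz ↦ ?_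
    rcases (show 1 ≤ z.re from hz).eq_or_lt with h1 | h1
    · exact h z h1.symm
    · exact ⟨F z, hd.continuousOn z h1⟩
  · rw [heq z hz, log_one_div_sub_one hz, hF]
    ring

lemma tendsto_log_one_div_sub_one :
    Tendsto (fun z : ℝ ↦ Real.log (1 / (z - 1))) (𝓝[>] 1) atTop := by
  refine Real.tendsto_log_atTop.comp ?_
  simp only [one_div]
  refine tendsto_inv_nhdsGT_zero.comp ?_
  refine tendsto_nhdsWithin_iff.mpr ⟨?_, ?_⟩
  · have : Tendsto (fun z : ℝ ↦ z - 1) (𝓝 1) (𝓝 (1 - 1)) := tendsto_id.sub_const 1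
    rw [sub_self] at this
    exact this.mono_left nhdsWithin_le_nhds
  · filter_upwards [self_mem_nhdsWithin] with z hz
    exact sub_pos.mpr (Set.mem_Ioi.mp hz)

/-- A weakly regular set has a Dirichlet density. -/
lemma tendsto_tsum_rpow_div_log {a : ℝ} {g : ℂ → ℂ} (hg : ContinuousOn g {z : ℂ | 1 ≤ z.re})
    (h : ∀ z : ℂ, 1 < z.re →
      (∑' p : S, ((p : ℕ) : ℂ) ^ (-z)) = a * Complex.log (1 / (z - 1)) + g z) :
    Tendsto (fun z : ℝ ↦ (∑' p : S, ((p : ℕ) : ℝ) ^ (-z)) / Real.log (1 / (z - 1)))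
      (𝓝[>] 1) (𝓝 a) := by
  have hc : Tendsto (fun z : ℝ ↦ (g z).re) (𝓝[>] 1) (𝓝 (g 1).re) := by
    have h1 : Tendsto (fun z : ℝ ↦ (z : ℂ)) (𝓝[>] 1) (𝓝[{z : ℂ | 1 ≤ z.re}] 1) := by
      refine tendsto_nhdsWithin_iff.mpr ⟨?_, ?_⟩
      · exact (Complex.continuous_ofReal.tendsto' 1 1 Complex.ofReal_one).mono_left
          nhdsWithin_le_nhds
      · filter_upwards [self_mem_nhdsWithin] with z hz
        simpa using le_of_lt (Set.mem_Ioi.mp hz)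
    exact (Complex.continuous_re.tendsto _).comp ((hg 1 (by simp)).tendsto.comp h1)
  have hlim := (hc.div_atTop tendsto_log_one_div_sub_one).const_add a
  rw [add_zero] at hlim
  refine hlim.congr' ?_
  filter_upwards [self_mem_nhdsWithin, tendsto_log_one_div_sub_one.eventually_gt_atTop 0]
    with z hz hlog
  have hz1 : (1 : ℝ) < z := hz
  have hre : ∑' p : S, ((p : ℕ) : ℝ) ^ (-z) = a * Real.log (1 / (z - 1)) + (g z).re := by
    have := congrArg Complex.re (h z (by simpa using hz1))
    rwa [← ofReal_tsum_prime_rpow, Complex.ofReal_re, Complex.add_re, ← Complex.ofReal_one,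
      ← Complex.ofReal_sub, ← Complex.ofReal_div,
      ← Complex.ofReal_log (by have := sub_pos.mpr hz1; positivity), ← Complex.ofReal_mul,
      Complex.ofReal_re] at this
  rw [hre]
  field_simp

lemma exists_tendsto_tsum_splitCompletelySet (K : Type*) [Field K] [NumberField K] [IsGalois ℚ K]
    {s₀ : ℂ} (hs₀ : s₀.re = 1) :
    ∃ l, Tendsto (fun s ↦ ∑' p : splitCompletelySet K (finrank ℚ K), ((p : ℕ) : ℂ) ^ (-s) +
      (1 / (finrank ℚ K : ℂ)) * Complex.log (s - 1)) (𝓝[{s | 1 < s.re}] s₀) (𝓝 l) := by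
  obtain ⟨l, hl⟩ := exists_tendsto_logIdealZeta_add_log K hs₀
  have hmono : 𝓝[{s : ℂ | 1 < s.re}] s₀ ≤ 𝓝[{s : ℂ | 1 ≤ s.re}] s₀ :=
    nhdsWithin_mono _ fun s hs ↦ le_of_lt (Set.mem_ofPred.mp hs)
  have h1 := (continuousOn_tsum_neg_log_one_sub_idealCpow_sub K s₀ hs₀.ge).tendsto.mono_left hmono
  have h2 := (continuousOn_tsum_idealCpow_not_split K s₀ hs₀.ge).tendsto.mono_left hmono
  have hn : (finrank ℚ K : ℂ) ≠ 0 := by exact_mod_cast (finrank_pos (R := ℚ) (M := K)).ne'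
  refine ⟨_, (((hl.sub h1).sub h2).const_mul (1 / (finrank ℚ K : ℂ))).congr' ?_⟩
  filter_upwards [self_mem_nhdsWithin] with s hs
  have hsum := summable_idealCpow_heightOneSpectrum (K := K) hs
  have hsplit (G : Set (HeightOneSpectrum (𝓞 K))) := (hsum.subtype G).tsum_add_tsum_compl
    (hsum.subtype Gᶜ)
  rw [logIdealZeta_eq_add hs, ← hsplit {v : HeightOneSpectrum (𝓞 K) |
    Ideal.absNorm v.asIdeal ∈ splitCompletelySet K (finrank ℚ K)}, tsum_idealCpow_split hs]
  field_simp
  ring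

end PrimeSum

/-- Let `K/ℚ` be a Galois number field of degree `n`. Then the set of rational
primes that split completely in `K` is weakly regular with Dirichlet density `1/n`. -/
theorem splitCompletelySet_weaklyRegular_density_inv_degree
    (K : Type*) [Field K] [NumberField K] [IsGalois ℚ K]
    (n : ℕ) (hn : Module.finrank ℚ K = n) :
    (∃ g : ℂ → ℂ, DifferentiableOn ℂ g {z : ℂ | 1 < z.re} ∧
      ContinuousOn g {z : ℂ | 1 ≤ z.re} ∧
      ∀ z : ℂ, 1 < z.re →
        (∑' p : splitCompletelySet K n, ((p : ℕ) : ℂ) ^ (-z)) =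
          (1 / n : ℂ) * Complex.log (1 / (z - 1)) + g z) ∧
    Tendsto
      (fun z : ℝ =>
        (∑' p : splitCompletelySet K n, ((p : ℕ) : ℝ) ^ (-z)) / Real.log (1 / (z - 1)))
      (𝓝[>] 1) (𝓝 (1 / n)) := by
  subst hn
  obtain ⟨g, hg₁, hg₂, hg₃⟩ := exists_weaklyRegular_of_tendsto
    (S := splitCompletelySet K (Module.finrank ℚ K)) (fun _ hp ↦ hp.1)
    (1 / (Module.finrank ℚ K : ℂ)) fun _ hs₀ ↦ exists_tendsto_tsum_splitCompletelySet K hs₀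
  refine ⟨⟨g, hg₁, hg₂, hg₃⟩, tendsto_tsum_rpow_div_log hg₂ fun z hz ↦ ?_⟩
  rw [hg₃ z hz]
  push_cast
  rfl
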